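/- arXiv:2004.14782 — 7 statements merged into one kernel-verified Lean document; each statement's English description precedes it below -/
import Mathlib

section
/- Let P be an extreme point of the time-ordered no-signaling polytope TONS that does not belong to the time-ordered local polytope TOLoc. Then P does not belong to the closure of the sequential quantum set Qseq (closure taken in the Euclidean space of all sequential boxes). -/
open scoped Classical Matrix

/-- A sequential box: joint probabilities `P iA iB oA oB = P(oA, oB | iA, iB)` for input
sequences `iA iB : Fin N → Fin m` and output sequences `oA oB : Fin N → Fin d`. -/
abbrev SeqBox (N m d : ℕ) :=
  (Fin N → Fin m) → (Fin N → Fin m) → (Fin N → Fin d) → (Fin N → Fin d) → ℝ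

/-- The time-ordered no-signaling polytope: non-negativity, normalization, and for every `k`,
the marginal obtained by summing the outputs of runs `≥ k` of one party (for a fixed prefix of
outputs of runs `< k`) is independent of that party's inputs in runs `≥ k`. -/
def TONS (N m d : ℕ) : Set (SeqBox N m d) :=
  {P | (∀ iA iB oA oB, 0 ≤ P iA iB oA oB) ∧
       (∀ iA iB, ∑ oA : Fin N → Fin d, ∑ oB : Fin N → Fin d, P iA iB oA oB = 1) ∧
       (∀ k : ℕ, ∀ iA iA' iB : Fin N → Fin m, ∀ oB : Fin N → Fin d,
          (∀ j : Fin N, (j : ℕ) < k → iA j = iA' j) →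
          ∀ oAfix : Fin N → Fin d,
            (∑ oA : Fin N → Fin d,
              if ∀ j : Fin N, (j : ℕ) < k → oA j = oAfix j then P iA iB oA oB else 0) =
            (∑ oA : Fin N → Fin d,
              if ∀ j : Fin N, (j : ℕ) < k → oA j = oAfix j then P iA' iB oA oB else 0)) ∧
       (∀ k : ℕ, ∀ iA iB iB' : Fin N → Fin m, ∀ oA : Fin N → Fin d,
          (∀ j : Fin N, (j : ℕ) < k → iB j = iB' j) →
          ∀ oBfix : Fin N → Fin d,
            (∑ oB : Fin N → Fin d,
              if ∀ j : Fin N, (j : ℕ) < k → oB j = oBfix j then P iA iB oA oB else 0) =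
            (∑ oB : Fin N → Fin d,
              if ∀ j : Fin N, (j : ℕ) < k → oB j = oBfix j then P iA iB' oA oB else 0))}

/-- The time-ordered local polytope: convex hull of the `{0,1}`-valued boxes in `TONS`. -/
def TOLoc (N m d : ℕ) : Set (SeqBox N m d) :=
  convexHull ℝ {P | P ∈ TONS N m d ∧ ∀ iA iB oA oB,
    P iA iB oA oB = 0 ∨ P iA iB oA oB = 1}

/-- The sequential measurement operator `E = Σ_α K₁† ⋯ K_N† K_N ⋯ K₁` built from Kraus
operators `K j i o α` for the runs `j = 1, …, N`. -/
noncomputable def seqMeas {n N m d r : ℕ}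
    (K : Fin N → Fin m → Fin d → Fin r → Matrix (Fin n) (Fin n) ℂ)
    (iJ : Fin N → Fin m) (oJ : Fin N → Fin d) : Matrix (Fin n) (Fin n) ℂ :=
  ∑ α : Fin N → Fin r,
    ((List.ofFn fun j => K j (iJ j) (oJ j) (α j)).reverse.prod)ᴴ *
      (List.ofFn fun j => K j (iJ j) (oJ j) (α j)).reverse.prod

/-- The tensor product `A ⊗ B` of two `n × n` matrices, acting on `ℂ^n ⊗ ℂ^n`. -/
noncomputable def tens2 {n : ℕ} (A B : Matrix (Fin n) (Fin n) ℂ) :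
    Matrix (Fin n × Fin n) (Fin n × Fin n) ℂ :=
  fun p q => A p.1 q.1 * B p.2 q.2

/-- The sequential quantum set: boxes realizable by sequential quantum measurements
(given by Kraus operators for each run) on a pure state. -/
def Qseq (N m d : ℕ) : Set (SeqBox N m d) :=
  {P | ∃ n : ℕ, 0 < n ∧ ∃ ψ : Fin n × Fin n → ℂ,
        (∑ p, Complex.normSq (ψ p)) = 1 ∧
        ∃ (r : ℕ) (KA KB : Fin N → Fin m → Fin d → Fin r → Matrix (Fin n) (Fin n) ℂ),
          (∀ j i, ∑ o : Fin d, ∑ α : Fin r, (KA j i o α)ᴴ * KA j i o α = 1) ∧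
          (∀ j i, ∑ o : Fin d, ∑ α : Fin r, (KB j i o α)ᴴ * KB j i o α = 1) ∧
          (∀ iA iB oA oB, (P iA iB oA oB : ℂ) =
            ∑ p, ∑ q, (starRingEnd ℂ) (ψ p) *
              tens2 (seqMeas KA iA oA) (seqMeas KB iB oB) p q * ψ q)}

open scoped Kronecker ComplexOrder MatrixOrder Matrix.Norms.L2Operator

/-! ### Time-ordered families -/

/-- A family `p i o`, indexed by input and output sequences, is time-ordered if its marginals over
the outputs of all runs `≥ k` depend only on the inputs of runs `< k`. -/
def TimeOrdered {N m d : ℕ} {V : Type*} [AddCommMonoid V]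
    (p : (Fin N → Fin m) → (Fin N → Fin d) → V) : Prop :=
  ∀ k : ℕ, ∀ i i' : Fin N → Fin m, (∀ j : Fin N, (j : ℕ) < k → i j = i' j) →
    ∀ ofix : Fin N → Fin d,
      (∑ o : Fin N → Fin d, if ∀ j : Fin N, (j : ℕ) < k → o j = ofix j then p i o else 0) =
      (∑ o : Fin N → Fin d, if ∀ j : Fin N, (j : ℕ) < k → o j = ofix j then p i' o else 0)

namespace TimeOrdered

variable {N m d : ℕ} {V W : Type*} [AddCommMonoid V] [AddCommMonoid W]
  {p q : (Fin N → Fin m) → (Fin N → Fin d) → V}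

theorem map (hp : TimeOrdered p) (f : V →+ W) : TimeOrdered fun i o => f (p i o) := by
  intro k i i' hi ofix
  have h := congrArg f (hp k i i' hi ofix)
  simpa only [map_sum, apply_ite f, map_zero] using h

theorem add (hp : TimeOrdered p) (hq : TimeOrdered q) :
    TimeOrdered fun i o => p i o + q i o := by
  intro k i i' hi ofix
  have h := congrArg₂ (· + ·) (hp k i i' hi ofix) (hq k i i' hi ofix)
  simp only [← Finset.sum_add_distrib] at h
  convert h using 2 with o _ o _ <;> split_ifs <;> simp

theorem const_mul {p : (Fin N → Fin m) → (Fin N → Fin d) → ℝ} (hp : TimeOrdered p) (c : ℝ) :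
    TimeOrdered fun i o => c * p i o :=
  hp.map (AddMonoidHom.mulLeft c)

theorem sum {ι : Type*} (s : Finset ι) {p : ι → (Fin N → Fin m) → (Fin N → Fin d) → V}
    (hp : ∀ x ∈ s, TimeOrdered (p x)) : TimeOrdered fun i o => ∑ x ∈ s, p x i o := by
  classical
  induction s using Finset.induction_on with
  | empty => intro k i i' _ ofix; simp
  | insert a s ha ih =>
    simp only [Finset.sum_insert ha]
    exact (hp a (by simp)).add (ih fun x hx => hp x (by simp [hx]))

theorem sum_eq (hp : TimeOrdered p) (i i' : Fin N → Fin m) : ∑ o, p i o = ∑ o, p i' o := by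
  by_cases h : Nonempty (Fin N → Fin d)
  · simpa using hp 0 i i' (by simp) h.some
  · rw [not_nonempty_iff] at h
    simp

theorem isClosed_ofPred :
    IsClosed {p : (Fin N → Fin m) → (Fin N → Fin d) → ℝ | TimeOrdered p} := by
  simp only [TimeOrdered, Set.ofPred_forall]
  refine isClosed_iInter fun k => isClosed_iInter fun i => isClosed_iInter fun i' =>
    isClosed_iInter fun _ => isClosed_iInter fun ofix => isClosed_eq ?_ ?_ <;>
  · refine continuous_finsetSum _ fun o _ => ?_
    split_ifs <;> fun_prop

/-- The deterministic family given by a causal strategy is time-ordered. -/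
theorem of_causal {s : (Fin N → Fin m) → (Fin N → Fin d)}
    (hs : ∀ (k : ℕ) (i i' : Fin N → Fin m), (∀ j : Fin N, (j : ℕ) < k → i j = i' j) →
      ∀ j : Fin N, (j : ℕ) < k → s i j = s i' j) :
    TimeOrdered fun i o => if o = s i then (1 : ℝ) else 0 := by
  intro k i i' hi ofix
  have key : ∀ i : Fin N → Fin m, (∑ o : Fin N → Fin d,
      if ∀ j : Fin N, (j : ℕ) < k → o j = ofix j then (if o = s i then (1 : ℝ) else 0) else 0) =
      if ∀ j : Fin N, (j : ℕ) < k → s i j = ofix j then 1 else 0 := by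
    intro i
    rw [Finset.sum_eq_single (s i)]
    · simp
    · intro o _ ho
      simp [ho]
    · simp
  rw [key, key]
  refine if_congr ?_ rfl rfl
  exact forall₂_congr fun j hj => by rw [hs k i i' hi j hj]

/-- A non-negative time-ordered family with positive total mass has a causal strategy in its
support: the lexicographically smallest output sequence of positive weight. -/
theorem exists_causal_pos {p : (Fin N → Fin m) → (Fin N → Fin d) → ℝ} (hp : TimeOrdered p)
    (h0 : ∀ i o, 0 ≤ p i o) (h1 : ∀ i, 0 < ∑ o, p i o) :
    ∃ s : (Fin N → Fin m) → (Fin N → Fin d), (∀ i, 0 < p i (s i)) ∧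
      ∀ (k : ℕ) (i i' : Fin N → Fin m), (∀ j : Fin N, (j : ℕ) < k → i j = i' j) →
        ∀ j : Fin N, (j : ℕ) < k → s i j = s i' j := by
  have hne : ∀ i, ∃ o : Fin N → Fin d, 0 < p i o ∧
      ∀ o' : Fin N → Fin d, 0 < p i o' → toLex o ≤ toLex o' := by
    intro i
    obtain ⟨o₁, -, ho₁⟩ := Finset.exists_lt_of_sum_lt
      (s := Finset.univ) (f := fun _ => (0 : ℝ)) (g := p i) (by simpa using h1 i)
    obtain ⟨o, ho, hmin⟩ := Finset.exists_min_image
      (Finset.univ.filter fun o => 0 < p i o) (fun o => toLex o) ⟨o₁, by simpa using ho₁⟩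
    exact ⟨o, by simpa using ho, fun o' ho' => hmin o' (by simpa using ho')⟩
  choose s hs hmin using hne
  refine ⟨s, hs, fun k i i' hi => ?_⟩
  have exists_extension : ∀ i i' : Fin N → Fin m, (∀ j : Fin N, (j : ℕ) < k → i j = i' j) →
      ∃ t, 0 < p i' t ∧ ∀ j : Fin N, (j : ℕ) < k → t j = s i j := by
    intro i i' hi
    have hpos : 0 < ∑ o : Fin N → Fin d,
        if ∀ j : Fin N, (j : ℕ) < k → o j = s i j then p i o else 0 := by
      refine Finset.sum_pos' (fun o _ => ?_) ⟨s i, Finset.mem_univ _, by simpa using hs i⟩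
      split_ifs
      exacts [h0 _ _, le_rfl]
    rw [hp k i i' hi (s i)] at hpos
    obtain ⟨t, -, ht⟩ := Finset.exists_lt_of_sum_lt
      (s := Finset.univ) (f := fun _ : Fin N → Fin d => (0 : ℝ)) (by simpa using hpos)
    split_ifs at ht with h
    · exact ⟨t, ht, h⟩
    · exact absurd ht (lt_irrefl _)
  obtain ⟨t, ht, hts⟩ := exists_extension i i' hi
  obtain ⟨t', ht', hts'⟩ := exists_extension i' i fun j hj => (hi j hj).symm
  have hlt : ∀ (a b b' : Fin N → Fin d) (j : Fin N), (j : ℕ) < k →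
      (∀ l : Fin N, (l : ℕ) < k → b l = b' l) → (∀ l < j, a l = b' l) → toLex a ≤ toLex b →
      a j ≤ b' j := by
    intro a b b' j hj hb hab hle
    by_contra! hgt
    refine absurd hle (not_le.2 ⟨j, fun l hl => ?_, ?_⟩)
    · simpa [hab l hl] using hb l (lt_trans hl hj)
    · simpa [hb j hj] using hgt
  intro j
  induction j using WellFoundedLT.induction with
  | ind j ih =>
    intro hj
    have hpre : ∀ l < j, s i l = s i' l := fun l hl => ih l hl (lt_trans hl hj)
    exact le_antisymm (hlt _ _ _ j hj hts' hpre (hmin i t' ht'))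
      (hlt _ _ _ j hj hts (fun l hl => (hpre l hl).symm) (hmin i' t ht))

end TimeOrdered

theorem mem_TONS_iff {N m d : ℕ} {P : SeqBox N m d} :
    P ∈ TONS N m d ↔ (∀ iA iB oA oB, 0 ≤ P iA iB oA oB) ∧
      (∀ iA iB, ∑ oA, ∑ oB, P iA iB oA oB = 1) ∧
      (∀ iB oB, TimeOrdered fun iA oA => P iA iB oA oB) ∧
      (∀ iA oA, TimeOrdered fun iB oB => P iA iB oA oB) :=
  ⟨fun ⟨h0, h1, hA, hB⟩ => ⟨h0, h1, fun iB oB k iA iA' => hA k iA iA' iB oB,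
      fun iA oA k iB iB' => hB k iA iB iB' oA⟩,
    fun ⟨h0, h1, hA, hB⟩ => ⟨h0, h1, fun k iA iA' iB oB => hA iB oB k iA iA',
      fun k iA iB iB' oA => hB iA oA k iB iB'⟩⟩

/-! ### Extreme points of the time-ordered no-signaling polytope -/

section Extreme

variable {N m d : ℕ} {P : SeqBox N m d}

theorem add_smul_mem_TONS {D : SeqBox N m d} (hP : P ∈ TONS N m d) (t : ℝ)
    (hA : ∀ iB oB, TimeOrdered fun iA oA => D iA iB oA oB)
    (hB : ∀ iA oA, TimeOrdered fun iB oB => D iA iB oA oB)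
    (hsum : ∀ iA iB, ∑ oA, ∑ oB, D iA iB oA oB = 0)
    (hle : ∀ iA iB oA oB, |t * D iA iB oA oB| ≤ P iA iB oA oB) :
    P + t • D ∈ TONS N m d := by
  obtain ⟨-, h1, hPA, hPB⟩ := mem_TONS_iff.1 hP
  refine mem_TONS_iff.2 ⟨fun iA iB oA oB => ?_, fun iA iB => ?_,
    fun iB oB => (hPA iB oB).add ((hA iB oB).const_mul t),
    fun iA oA => (hPB iA oA).add ((hB iA oA).const_mul t)⟩
  · have := neg_le_of_abs_le (hle iA iB oA oB)
    simp only [Pi.add_apply, Pi.smul_apply, smul_eq_mul]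
    linarith
  · simp [Finset.sum_add_distrib, ← Finset.mul_sum, h1, hsum]

/-- An extreme point of `TONS` is determined, up to scaling, by its zeros. -/
theorem eq_smul_of_mem_extremePoints {Y : SeqBox N m d}
    (hext : P ∈ Set.extremePoints ℝ (TONS N m d))
    (hA : ∀ iB oB, TimeOrdered fun iA oA => Y iA iB oA oB)
    (hB : ∀ iA oA, TimeOrdered fun iB oB => Y iA iB oA oB)
    (h0 : ∀ iA iB oA oB, P iA iB oA oB = 0 → Y iA iB oA oB = 0)
    {c : ℝ} (hc : ∀ iA iB, ∑ oA, ∑ oB, Y iA iB oA oB = c) : Y = c • P := by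
  obtain ⟨hP0, hP1, hPA, hPB⟩ := mem_TONS_iff.1 hext.1
  set D : SeqBox N m d := Y + (-c) • P with hD
  have hDA : ∀ iB oB, TimeOrdered fun iA oA => D iA iB oA oB :=
    fun iB oB => (hA iB oB).add ((hPA iB oB).const_mul (-c))
  have hDB : ∀ iA oA, TimeOrdered fun iB oB => D iA iB oA oB :=
    fun iA oA => (hB iA oA).add ((hPB iA oA).const_mul (-c))
  have hDsum : ∀ iA iB, ∑ oA, ∑ oB, D iA iB oA oB = 0 := by
    intro iA iB
    have : ∑ oA, ∑ oB, D iA iB oA oB = ∑ oA, ∑ oB, Y iA iB oA oB +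
        (-c) * ∑ oA, ∑ oB, P iA iB oA oB := by
      simp only [Finset.mul_sum, ← Finset.sum_add_distrib]
      rfl
    rw [this, hc, hP1]
    ring
  set f : (Fin N → Fin m) × (Fin N → Fin m) × (Fin N → Fin d) × (Fin N → Fin d) → ℝ :=
    fun x => |D x.1 x.2.1 x.2.2.1 x.2.2.2| / P x.1 x.2.1 x.2.2.1 x.2.2.2 with hf
  have hf0 : ∀ x, 0 ≤ f x := fun x => div_nonneg (abs_nonneg _) (hP0 _ _ _ _)
  have hC0 : 0 ≤ ∑ x, f x := Finset.sum_nonneg fun x _ => hf0 x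
  set ε : ℝ := (∑ x, f x + 1)⁻¹ with hε
  have hεpos : 0 < ε := by positivity
  have hle : ∀ iA iB oA oB, |ε * D iA iB oA oB| ≤ P iA iB oA oB := by
    intro iA iB oA oB
    rcases (hP0 iA iB oA oB).eq_or_lt with hz | hpos
    · have : D iA iB oA oB = 0 := by simp [hD, h0 _ _ _ _ hz.symm, ← hz]
      simp [this, ← hz]
    · have h := Finset.single_le_sum (fun x _ => hf0 x) (Finset.mem_univ (iA, iB, oA, oB))
      have h' : |D iA iB oA oB| ≤ (∑ x, f x + 1) * P iA iB oA oB := by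
        rw [← div_le_iff₀ hpos]
        linarith
      rw [abs_mul, abs_of_pos hεpos, hε, inv_mul_le_iff₀ (by positivity)]
      exact h'
  have hplus := add_smul_mem_TONS hext.1 ε hDA hDB hDsum hle
  have hminus := add_smul_mem_TONS hext.1 (-ε) hDA hDB hDsum (by simpa using hle)
  have hseg : P ∈ openSegment ℝ (P + ε • D) (P + (-ε) • D) :=
    ⟨1 / 2, 1 / 2, by norm_num, by norm_num, by norm_num, by module⟩
  have hzero : P + ε • D = P := hext.2 hplus hminus hseg
  have hD0 : D = 0 := by simpa [hεpos.ne'] using hzero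
  have := hD.symm.trans hD0
  rwa [neg_smul, ← sub_eq_add_neg, sub_eq_zero] at this

/-- An extreme point of `TONS` that is a product of its marginals is deterministic. -/
theorem mem_TOLoc_of_eq_mul (hext : P ∈ Set.extremePoints ℝ (TONS N m d))
    {a b : (Fin N → Fin m) → (Fin N → Fin d) → ℝ} (ha : TimeOrdered a) (hb : TimeOrdered b)
    (ha0 : ∀ i o, 0 ≤ a i o) (hb0 : ∀ i o, 0 ≤ b i o)
    (ha1 : ∀ i, 0 < ∑ o, a i o) (hb1 : ∀ i, 0 < ∑ o, b i o)
    (hab : ∀ iA iB oA oB, P iA iB oA oB = a iA oA * b iB oB) : P ∈ TOLoc N m d := by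
  obtain ⟨s, hs, hsc⟩ := ha.exists_causal_pos ha0 ha1
  obtain ⟨t, ht, htc⟩ := hb.exists_causal_pos hb0 hb1
  set Y : SeqBox N m d := fun iA iB oA oB =>
    (if oA = s iA then 1 else 0) * (if oB = t iB then 1 else 0) with hY
  have hYP : Y = (1 : ℝ) • P := by
    refine eq_smul_of_mem_extremePoints hext (fun iB oB => ?_) (fun iA oA => ?_) ?_ ?_
    · exact (TimeOrdered.of_causal hsc).map (AddMonoidHom.mulRight _)
    · exact (TimeOrdered.of_causal htc).const_mul _
    · intro iA iB oA oB h
      by_contra hne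
      simp only [hY] at hne
      split_ifs at hne with h₁ h₂ <;> simp_all [(hs _).ne', (ht _).ne']
    · intro iA iB
      simp [hY]
  rw [one_smul] at hYP
  refine subset_convexHull ℝ _ ⟨hext.1, fun iA iB oA oB => ?_⟩
  rw [← hYP]
  simp only [hY]
  split_ifs <;> simp

end Extreme

/-! ### Sequential measurement operators -/

section Measurement

variable {n N m d r : ℕ}

theorem seqMeas_succ (K : Fin (N + 1) → Fin m → Fin d → Fin r → Matrix (Fin n) (Fin n) ℂ)
    (i : Fin (N + 1) → Fin m) (o : Fin (N + 1) → Fin d) :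
    seqMeas K i o = ∑ α : Fin r, (K 0 (i 0) (o 0) α)ᴴ *
      seqMeas (fun j => K j.succ) (fun j => i j.succ) (fun j => o j.succ) * K 0 (i 0) (o 0) α := by
  unfold seqMeas
  rw [← (Fin.consEquiv fun _ => Fin r).sum_comp, Fintype.sum_prod_type]
  refine Finset.sum_congr rfl fun α _ => ?_
  rw [Finset.mul_sum, Finset.sum_mul]
  refine Finset.sum_congr rfl fun β _ => ?_
  simp [Fin.consEquiv, List.ofFn_succ, Matrix.mul_assoc]

theorem seqMeas_posSemidef (K : Fin N → Fin m → Fin d → Fin r → Matrix (Fin n) (Fin n) ℂ)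
    (i : Fin N → Fin m) (o : Fin N → Fin d) : (seqMeas K i o).PosSemidef :=
  Matrix.posSemidef_sum _ fun _ _ => Matrix.posSemidef_conjTranspose_mul_self _

theorem sum_fin_succ_ite {V : Type*} [AddCommMonoid V] (k : ℕ) (ofix : Fin (N + 1) → Fin d)
    (f : (Fin (N + 1) → Fin d) → V) :
    (∑ o : Fin (N + 1) → Fin d,
      if ∀ j : Fin (N + 1), (j : ℕ) < k + 1 → o j = ofix j then f o else 0) =
    ∑ o : Fin N → Fin d,
      if ∀ j : Fin N, (j : ℕ) < k → o j = ofix j.succ then f (Fin.cons (ofix 0) o) else 0 := by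
  rw [← (Fin.consEquiv fun _ => Fin d).sum_comp, Fintype.sum_prod_type,
    Finset.sum_eq_single (ofix 0)]
  · refine Finset.sum_congr rfl fun o _ => ?_
    simp [Fin.consEquiv, Fin.forall_fin_succ]
  · intro x _ hx
    simp [Fin.consEquiv, Fin.forall_fin_succ, hx]
  · simp

theorem sum_seqMeas (K : Fin N → Fin m → Fin d → Fin r → Matrix (Fin n) (Fin n) ℂ)
    (hK : ∀ j i, ∑ o : Fin d, ∑ α : Fin r, (K j i o α)ᴴ * K j i o α = 1)
    (i : Fin N → Fin m) : ∑ o, seqMeas K i o = 1 := by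
  induction N with
  | zero => simp [seqMeas]
  | succ N ih =>
    rw [← (Fin.consEquiv fun _ => Fin d).sum_comp, Fintype.sum_prod_type, ← hK 0 (i 0)]
    refine Finset.sum_congr rfl fun x _ => ?_
    simp only [seqMeas_succ, Fin.consEquiv, Equiv.coe_fn_mk, Fin.cons_zero, Fin.cons_succ]
    rw [Finset.sum_comm]
    refine Finset.sum_congr rfl fun α _ => ?_
    rw [← Finset.sum_mul, ← Finset.mul_sum, ih _ fun j => hK j.succ, Matrix.mul_one]

theorem timeOrdered_seqMeas (K : Fin N → Fin m → Fin d → Fin r → Matrix (Fin n) (Fin n) ℂ)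
    (hK : ∀ j i, ∑ o : Fin d, ∑ α : Fin r, (K j i o α)ᴴ * K j i o α = 1) :
    TimeOrdered (seqMeas K) := by
  induction N with
  | zero =>
    intro k i i' _ ofix
    rw [Subsingleton.elim i i']
  | succ N ih =>
    intro k i i' hi ofix
    cases k with
    | zero => simpa using (sum_seqMeas K hK i).trans (sum_seqMeas K hK i').symm
    | succ k =>
      have h0 : i 0 = i' 0 := hi 0 (by simp)
      have h := ih (fun j => K j.succ) (fun j => hK j.succ) k (fun j => i j.succ)
        (fun j => i' j.succ) (fun j hj => hi j.succ (by simpa using hj)) (fun j => ofix j.succ)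
      have key : ∀ i : Fin (N + 1) → Fin m, (∑ o : Fin N → Fin d,
          if ∀ j : Fin N, (j : ℕ) < k → o j = ofix j.succ
            then seqMeas K i (Fin.cons (ofix 0) o) else 0) =
          ∑ α : Fin r, (K 0 (i 0) (ofix 0) α)ᴴ * (∑ o : Fin N → Fin d,
            if ∀ j : Fin N, (j : ℕ) < k → o j = ofix j.succ
              then seqMeas (fun j => K j.succ) (fun j => i j.succ) o else 0) *
            K 0 (i 0) (ofix 0) α := by
        intro i
        simp only [Finset.mul_sum, Finset.sum_mul, seqMeas_succ, Fin.cons_zero, Fin.cons_succ]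
        rw [Finset.sum_comm]
        refine Finset.sum_congr rfl fun o _ => ?_
        split_ifs <;> simp
      rw [sum_fin_succ_ite, sum_fin_succ_ite, key, key, h0, h]

theorem one_sub_seqMeas_posSemidef
    (K : Fin N → Fin m → Fin d → Fin r → Matrix (Fin n) (Fin n) ℂ)
    (hK : ∀ j i, ∑ o : Fin d, ∑ α : Fin r, (K j i o α)ᴴ * K j i o α = 1)
    (i : Fin N → Fin m) (o : Fin N → Fin d) : (1 - seqMeas K i o).PosSemidef := by
  rw [← sum_seqMeas K hK i, ← Finset.add_sum_erase _ _ (Finset.mem_univ o), add_sub_cancel_left]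
  exact Matrix.posSemidef_sum _ fun _ _ => seqMeas_posSemidef K i _

end Measurement

/-! ### Expectation values -/

section Expectation

variable {ι : Type*} [Fintype ι]

theorem Matrix.PosSemidef.sq_re_dotProduct_mulVec_le {E : Matrix ι ι ℂ} (hE : E.PosSemidef)
    (u v : ι → ℂ) : (star u ⬝ᵥ E *ᵥ v).re ^ 2 ≤
      (star u ⬝ᵥ E *ᵥ u).re * (star v ⬝ᵥ E *ᵥ v).re := by
  classical
  obtain ⟨B, rfl⟩ : ∃ B : Matrix ι ι ℂ, E = Bᴴ * B :=
    CStarAlgebra.nonneg_iff_eq_star_mul_self.mp hE.nonneg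
  have key : ∀ x y : ι → ℂ, star x ⬝ᵥ (Bᴴ * B) *ᵥ y =
      inner ℂ (WithLp.toLp 2 (B *ᵥ x)) (WithLp.toLp 2 (B *ᵥ y)) := by
    intro x y
    rw [EuclideanSpace.inner_toLp_toLp, ← Matrix.mulVec_mulVec, Matrix.dotProduct_mulVec,
      ← Matrix.star_mulVec, dotProduct_comm]
  rw [key, key, key, sq]
  calc _ ≤ ‖inner ℂ (WithLp.toLp 2 (B *ᵥ u)) (WithLp.toLp 2 (B *ᵥ v))‖ *
        ‖inner ℂ (WithLp.toLp 2 (B *ᵥ v)) (WithLp.toLp 2 (B *ᵥ u))‖ := by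
        rw [norm_inner_symm (WithLp.toLp 2 (B *ᵥ v)), ← sq, ← sq]
        exact sq_le_sq' (neg_le_of_abs_le (Complex.abs_re_le_norm _)) (Complex.re_le_norm _)
    _ ≤ _ := inner_mul_inner_self_le _ _

theorem Matrix.PosSemidef.re_dotProduct_mulVec_le [DecidableEq ι] {E : Matrix ι ι ℂ}
    (hE : (1 - E).PosSemidef) (u : ι → ℂ) :
    (star u ⬝ᵥ E *ᵥ u).re ≤ (star u ⬝ᵥ u).re := by
  have h := hE.re_dotProduct_nonneg u
  simpa [Matrix.sub_mulVec] using h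

/-- A contraction of the form `0 ≤ E ≤ 1` does not increase norms. -/
theorem Matrix.PosSemidef.re_star_mulVec_dotProduct_le [DecidableEq ι] {E : Matrix ι ι ℂ}
    (hE : E.PosSemidef) (hE' : (1 - E).PosSemidef) (v : ι → ℂ) :
    (star (E *ᵥ v) ⬝ᵥ E *ᵥ v).re ≤ (star v ⬝ᵥ v).re := by
  have h := hE.sq_re_dotProduct_mulVec_le (E *ᵥ v) v
  have h1 := Matrix.PosSemidef.re_dotProduct_mulVec_le hE' (E *ᵥ v)
  have h2 := Matrix.PosSemidef.re_dotProduct_mulVec_le hE' v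
  have h3 := hE.re_dotProduct_nonneg v
  have h4 := hE.re_dotProduct_nonneg (E *ᵥ v)
  simp only [RCLike.re_eq_complex_re] at h3 h4
  nlinarith [mul_le_mul h1 h2 h3 (h4.trans h1)]

theorem Matrix.PosSemidef.one_sub_kronecker {κ : Type*} [Fintype κ] [DecidableEq ι]
    [DecidableEq κ] {A : Matrix ι ι ℂ} {B : Matrix κ κ ℂ} (hA : A.PosSemidef)
    (hA' : (1 - A).PosSemidef) (hB' : (1 - B).PosSemidef) : (1 - A ⊗ₖ B).PosSemidef := by
  have h : 1 - A ⊗ₖ B = (1 - A) ⊗ₖ (1 : Matrix κ κ ℂ) + A ⊗ₖ (1 - B) := by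
    ext ⟨i, k⟩ ⟨j, l⟩
    rw [← Matrix.one_kronecker_one]
    simp only [Matrix.sub_apply, Matrix.add_apply, Matrix.kronecker_apply]
    ring
  rw [h]
  exact (hA'.kronecker Matrix.PosSemidef.one).add (hA.kronecker hB')

/-- The real part of `⟨ψ| A ⊗ B |ψ⟩`, as a biadditive map. -/
noncomputable def expectation {κ : Type*} [Fintype κ] (ψ : ι × κ → ℂ) :
    Matrix ι ι ℂ →+ Matrix κ κ ℂ →+ ℝ :=
  AddMonoidHom.mk' (fun A => AddMonoidHom.mk' (fun B => (star ψ ⬝ᵥ (A ⊗ₖ B) *ᵥ ψ).re)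
    (fun B B' => by
      rw [Matrix.kronecker_add, Matrix.add_mulVec, dotProduct_add, Complex.add_re]))
    (fun A A' => by
      ext B
      simp only [AddMonoidHom.mk'_apply, AddMonoidHom.add_apply]
      rw [Matrix.add_kronecker, Matrix.add_mulVec, dotProduct_add, Complex.add_re])

theorem expectation_apply {κ : Type*} [Fintype κ] (ψ : ι × κ → ℂ) (A : Matrix ι ι ℂ)
    (B : Matrix κ κ ℂ) : expectation ψ A B = (star ψ ⬝ᵥ (A ⊗ₖ B) *ᵥ ψ).re :=
  rfl

end Expectation

/-! ### A compact relaxation of the sequential quantum set -/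

/-- Pairs of a box `P` and a family `Y iA oA` of steered boxes: each `Y iA oA` is time-ordered, is
dominated by `P`, and its `B`-marginal is the slice `P iA · oA ·`. -/
def steeringRelaxation (N m d : ℕ) :
    Set (SeqBox N m d × ((Fin N → Fin m) → (Fin N → Fin d) → SeqBox N m d)) :=
  {z | z ∈ Set.Icc 0 1 ×ˢ Set.Icc (-1) 1 ∧
    (∀ iA oA iB oB', TimeOrdered fun iA' oA' => z.2 iA oA iA' iB oA' oB') ∧
    (∀ iA oA iA' oA', TimeOrdered fun iB oB => z.2 iA oA iA' iB oA' oB) ∧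
    (∀ iA oA iA' iB oA' oB, z.2 iA oA iA' iB oA' oB ^ 2 ≤ z.1 iA' iB oA' oB) ∧
    (∀ iA oA iA' iB oB, ∑ oA', z.2 iA oA iA' iB oA' oB = z.1 iA iB oA oB)}

set_option synthInstance.maxSize 1000 in
theorem isCompact_steeringRelaxation (N m d : ℕ) : IsCompact (steeringRelaxation N m d) := by
  simp only [steeringRelaxation, Set.ofPred_and, Set.ofPred_forall]
  refine (isCompact_Icc.prod isCompact_Icc).inter_right ?_
  refine IsClosed.inter ?_ (IsClosed.inter ?_ (IsClosed.inter ?_ ?_))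
  · exact isClosed_iInter fun iA => isClosed_iInter fun oA => isClosed_iInter fun iB =>
    isClosed_iInter fun oB => TimeOrdered.isClosed_ofPred.preimage (by fun_prop)
  · exact isClosed_iInter fun iA => isClosed_iInter fun oA => isClosed_iInter fun iB =>
    isClosed_iInter fun oB => TimeOrdered.isClosed_ofPred.preimage (by fun_prop)
  · exact isClosed_iInter fun iA => isClosed_iInter fun oA => isClosed_iInter fun iA' =>
    isClosed_iInter fun iB => isClosed_iInter fun oA' => isClosed_iInter fun oB =>
    isClosed_le (by fun_prop) (by fun_prop)
  · exact isClosed_iInter fun iA => isClosed_iInter fun oA => isClosed_iInter fun iA' =>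
    isClosed_iInter fun iB => isClosed_iInter fun oB =>
    isClosed_eq (by fun_prop) (by fun_prop)

theorem Qseq_subset_image_steeringRelaxation (N m d : ℕ) :
    Qseq N m d ⊆ Prod.fst '' steeringRelaxation N m d := by
  rintro P ⟨n, -, ψ, hψ, r, KA, KB, hKA, hKB, hP⟩
  have hψ1 : (star ψ ⬝ᵥ ψ).re = 1 := by
    rw [← hψ, dotProduct, Complex.re_sum]
    refine Finset.sum_congr rfl fun p _ => ?_
    simp [Complex.normSq_apply]
  have hPE : ∀ iA iB oA oB,
      P iA iB oA oB = expectation ψ (seqMeas KA iA oA) (seqMeas KB iB oB) := by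
    intro iA iB oA oB
    have h : (P iA iB oA oB : ℂ) =
        star ψ ⬝ᵥ (seqMeas KA iA oA ⊗ₖ seqMeas KB iB oB) *ᵥ ψ := by
      rw [hP]
      simp only [dotProduct, Matrix.mulVec, Finset.mul_sum, ← mul_assoc]
      rfl
    rw [expectation_apply, ← h, Complex.ofReal_re]
  have hpos : ∀ iA iB oA oB, (seqMeas KA iA oA ⊗ₖ seqMeas KB iB oB).PosSemidef :=
    fun iA iB oA oB => (seqMeas_posSemidef KA iA oA).kronecker (seqMeas_posSemidef KB iB oB)
  have hle : ∀ iA iB oA oB, (1 - seqMeas KA iA oA ⊗ₖ seqMeas KB iB oB).PosSemidef :=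
    fun iA iB oA oB => (seqMeas_posSemidef KA iA oA).one_sub_kronecker
      (one_sub_seqMeas_posSemidef KA hKA iA oA) (one_sub_seqMeas_posSemidef KB hKB iB oB)
  have hP0 : ∀ iA iB oA oB, 0 ≤ P iA iB oA oB := by
    intro iA iB oA oB
    rw [hPE, expectation_apply]
    exact (hpos iA iB oA oB).re_dotProduct_nonneg ψ
  have hP1 : ∀ iA iB oA oB, P iA iB oA oB ≤ 1 := by
    intro iA iB oA oB
    rw [hPE, expectation_apply, ← hψ1]
    exact Matrix.PosSemidef.re_dotProduct_mulVec_le (hle iA iB oA oB) ψ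
  set Y : (Fin N → Fin m) → (Fin N → Fin d) → SeqBox N m d := fun iA oA iA' iB oA' oB =>
    expectation ψ (seqMeas KA iA oA * seqMeas KA iA' oA') (seqMeas KB iB oB) with hY
  have hYsq : ∀ iA oA iA' iB oA' oB, Y iA oA iA' iB oA' oB ^ 2 ≤ P iA' iB oA' oB := by
    intro iA oA iA' iB oA' oB
    set G := seqMeas KA iA oA ⊗ₖ (1 : Matrix (Fin n) (Fin n) ℂ) with hG
    set E := seqMeas KA iA' oA' ⊗ₖ seqMeas KB iB oB with hE
    have hGpos : G.PosSemidef := (seqMeas_posSemidef KA iA oA).kronecker Matrix.PosSemidef.one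
    have hGle : (1 - G).PosSemidef := (seqMeas_posSemidef KA iA oA).one_sub_kronecker
      (one_sub_seqMeas_posSemidef KA hKA iA oA) (by simpa using Matrix.PosSemidef.zero)
    have hYu : Y iA oA iA' iB oA' oB = (star (G *ᵥ ψ) ⬝ᵥ E *ᵥ ψ).re := by
      have hmul : (seqMeas KA iA oA * seqMeas KA iA' oA') ⊗ₖ seqMeas KB iB oB = G * E := by
        rw [hG, hE, ← Matrix.mul_kronecker_mul, Matrix.one_mul]
      simp only [hY]
      rw [expectation_apply, hmul, Matrix.star_mulVec, hGpos.isHermitian.eq,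
        ← Matrix.dotProduct_mulVec, Matrix.mulVec_mulVec]
    have h1 := (hpos iA' iB oA' oB).sq_re_dotProduct_mulVec_le (G *ᵥ ψ) ψ
    have h2 := Matrix.PosSemidef.re_dotProduct_mulVec_le (hle iA' iB oA' oB) (G *ᵥ ψ)
    have h3 := hGpos.re_star_mulVec_dotProduct_le hGle ψ
    rw [← expectation_apply ψ, ← hPE] at h1
    rw [hYu]
    exact h1.trans (mul_le_of_le_one_left (hP0 _ _ _ _) (by linarith))
  have hYabs : ∀ iA oA iA' iB oA' oB, |Y iA oA iA' iB oA' oB| ≤ 1 := by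
    intro iA oA iA' iB oA' oB
    rw [← sq_le_one_iff_abs_le_one]
    exact (hYsq _ _ _ _ _ _).trans (hP1 _ _ _ _)
  refine ⟨(P, Y), ⟨⟨⟨hP0, hP1⟩, ?_, ?_⟩, ?_, ?_, hYsq, ?_⟩, rfl⟩
  · exact fun _ _ _ _ _ _ => (abs_le.1 (hYabs _ _ _ _ _ _)).1
  · exact fun _ _ _ _ _ _ => (abs_le.1 (hYabs _ _ _ _ _ _)).2
  · intro iA oA iB oB
    exact (timeOrdered_seqMeas KA hKA).map
      (((expectation ψ).flip (seqMeas KB iB oB)).comp (AddMonoidHom.mulLeft (seqMeas KA iA oA)))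
  · intro iA oA iA' oA'
    exact (timeOrdered_seqMeas KB hKB).map
      (expectation ψ (seqMeas KA iA oA * seqMeas KA iA' oA'))
  · intro iA oA iA' iB oB
    simp only [hY]
    rw [hPE, ← AddMonoidHom.finsetSum_apply, ← map_sum, ← Finset.mul_sum,
      sum_seqMeas KA hKA, Matrix.mul_one]

set_option synthInstance.maxSize 1000 in
theorem closure_Qseq_subset_image_steeringRelaxation (N m d : ℕ) :
    closure (Qseq N m d) ⊆ Prod.fst '' steeringRelaxation N m d :=
  closure_minimal (Qseq_subset_image_steeringRelaxation N m d)
    ((isCompact_steeringRelaxation N m d).image continuous_fst).isClosed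

/-- An extremal box of the time-ordered no-signaling polytope which is not time-ordered local
does not lie in the closure of the sequential quantum set. -/
theorem extremal_TONS_nonlocal_not_in_closure_Qseq
    (N m d : ℕ) (hN : 0 < N) (hm : 0 < m) (hd : 0 < d)
    (P : SeqBox N m d)
    (hext : P ∈ Set.extremePoints ℝ (TONS N m d))
    (hnl : P ∉ TOLoc N m d) :
    P ∉ closure (Qseq N m d) := by
  intro hP
  obtain ⟨⟨P', Y⟩, ⟨-, hYA, hYB, hYsq, hYsum⟩, rfl⟩ :=
    closure_Qseq_subset_image_steeringRelaxation N m d hP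
  dsimp only at *
  obtain ⟨hP0, hP1, hPA, hPB⟩ := mem_TONS_iff.1 hext.1
  let i₀ : Fin N → Fin m := fun _ => ⟨0, hm⟩
  set a : (Fin N → Fin m) → (Fin N → Fin d) → ℝ := fun iA oA => ∑ oB, P' iA i₀ oA oB with ha
  set b : (Fin N → Fin m) → (Fin N → Fin d) → ℝ := fun iB oB => ∑ oA, P' i₀ iB oA oB with hb
  have hYP : ∀ iA oA, Y iA oA = a iA oA • P' := by
    intro iA oA
    refine eq_smul_of_mem_extremePoints hext (hYA iA oA) (hYB iA oA) ?_ ?_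
    · intro iA' iB oA' oB h
      have := hYsq iA oA iA' iB oA' oB
      rw [h] at this
      exact pow_eq_zero_iff two_ne_zero |>.1 (le_antisymm this (sq_nonneg _))
    · intro iA' iB
      rw [Finset.sum_comm]
      simp only [hYsum]
      exact (hPB iA oA).sum_eq iB i₀
  refine hnl (mem_TOLoc_of_eq_mul hext (a := a) (b := b)
    (TimeOrdered.sum _ fun oB _ => hPA i₀ oB) (TimeOrdered.sum _ fun oA _ => hPB i₀ oA)
    (fun i o => Finset.sum_nonneg fun _ _ => hP0 _ _ _ _)
    (fun i o => Finset.sum_nonneg fun _ _ => hP0 _ _ _ _) ?_ ?_ ?_)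
  · intro i
    simp [ha, hP1]
  · intro i
    rw [hb, Finset.sum_comm, hP1]
    exact one_pos
  · intro iA iB oA oB
    rw [← hYsum iA oA i₀ iB oB, hYP]
    simp [hb, Finset.mul_sum]
end

section
/- Let P₁, P₂, P₃, P₄ be pairwise distinct rank-one orthogonal projections on ℂ^d and let p₁, p₂, p₃, p₄ > 0 satisfy p₁P₁ + p₂P₂ = p₃P₃ + p₄P₄. If q₁, q₂, q₃, q₄ ≥ 0 satisfy q₁P₁ + q₂P₂ = q₃P₃ + q₄P₄, then there exists a real α ≥ 0 such that q_i = α·p_i for all i ∈ {1,2,3,4}. -/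
open scoped Classical Matrix

/-- Rank-one orthogonal projection on `ℂ^d`. -/
def IsRankOneProj {d : ℕ} (P : Matrix (Fin d) (Fin d) ℂ) : Prop :=
  P.IsHermitian ∧ P * P = P ∧ P.rank = 1

/-- The trace of an idempotent matrix over a field is its rank. -/
theorem Matrix.trace_eq_rank_of_mul_self_eq {n K : Type*} [Fintype n] [DecidableEq n] [Field K]
    {A : Matrix n n K} (hA : A * A = A) : A.trace = (A.rank : K) := by
  have hidem : IsIdempotentElem (Matrix.toLin' A) := by
    rw [IsIdempotentElem, Module.End.mul_eq_comp, ← Matrix.toLin'_mul, hA]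
  have htrace := (LinearMap.IsIdempotentElem.isProj_range _ hidem).trace
  rw [Matrix.trace_toLin'_eq] at htrace
  rw [htrace, Matrix.rank, Matrix.toLin'_apply']

/-- A rank-one projection has trace one. -/
theorem IsRankOneProj.trace_eq_one {d : ℕ} {P : Matrix (Fin d) (Fin d) ℂ}
    (hP : IsRankOneProj P) : P.trace = 1 := by
  rw [Matrix.trace_eq_rank_of_mul_self_eq hP.2.1, hP.2.2, Nat.cast_one]

open scoped ComplexOrder in
/-- An affine combination of two distinct Hermitian idempotents is idempotent only at the two
endpoints. -/
theorem eq_or_eq_of_affine_combination_idempotent {d : ℕ} {P Q R : Matrix (Fin d) (Fin d) ℂ}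
    (hP : P * P = P) (hQ : Q.IsHermitian) (hQQ : Q * Q = Q) (hR : R.IsHermitian)
    (hRR : R * R = R) {t : ℝ} (h : P = (1 - t) • Q + t • R) : P = Q ∨ P = R ∨ Q = R := by
  have hsq : ((1 - t) * t) • ((Q - R) * (Q - R)) = P - P * P := by
    rw [h]
    simp only [sub_mul, mul_sub, add_mul, mul_add, smul_mul_assoc, mul_smul_comm, hQQ, hRR]
    module
  rw [hP, sub_self, smul_eq_zero, mul_eq_zero] at hsq
  rcases hsq with (ht | ht) | hsub
  · right; left
    simpa [ht, ← sub_eq_zero.mp ht] using h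
  · left
    simpa [ht] using h
  · right; right
    have hherm : (Q - R)ᴴ = Q - R := hQ.sub hR
    rw [← sub_eq_zero, ← Matrix.conjTranspose_mul_self_eq_zero, hherm, hsub]

/-- In a linear relation between three distinct rank-one projections the first coefficient
vanishes. -/
theorem IsRankOneProj.coeff_eq_zero {d : ℕ} {P Q R : Matrix (Fin d) (Fin d) ℂ}
    (hP : IsRankOneProj P) (hQ : IsRankOneProj Q) (hR : IsRankOneProj R)
    (hPQ : P ≠ Q) (hPR : P ≠ R) (hQR : Q ≠ R) {a b c : ℝ}
    (h : a • P + b • Q + c • R = 0) : a = 0 := by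
  by_contra ha
  have hsum : a + b + c = 0 := by
    have htrace := congrArg Matrix.trace h
    simp only [Matrix.trace_add, Matrix.trace_smul, hP.trace_eq_one, hQ.trace_eq_one,
      hR.trace_eq_one, Matrix.trace_zero, Complex.real_smul, mul_one] at htrace
    exact_mod_cast htrace
  have hcomb : P = (1 - (-c / a)) • Q + (-c / a) • R := by
    have hb : 1 - (-c / a) = -b / a := by
      field_simp
      linarith
    have hinv := congrArg (fun M => a⁻¹ • M) h
    simp only [smul_add, smul_smul, inv_mul_cancel₀ ha, one_smul, smul_zero] at hinv
    rw [hb, ← sub_eq_zero, ← hinv]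
    module
  rcases eq_or_eq_of_affine_combination_idempotent hP.2.1 hQ.1 hQ.2.1 hR.1 hR.2.1 hcomb
    with h | h | h
  exacts [hPQ h, hPR h, hQR h]

/-- If `p₁P₁ + p₂P₂ = p₃P₃ + p₄P₄` with pairwise distinct rank-one projections `Pᵢ` and
positive weights `pᵢ`, then any nonnegative solution `qᵢ` of the same equation is a common
nonnegative multiple of the `pᵢ`. -/
theorem typeIII_row_rigidity (d : ℕ) (P : Fin 4 → Matrix (Fin d) (Fin d) ℂ)
    (hproj : ∀ i, IsRankOneProj (P i))
    (hdist : ∀ i j : Fin 4, i ≠ j → P i ≠ P j)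
    (p : Fin 4 → ℝ) (hp : ∀ i, 0 < p i)
    (hpeq : p 0 • P 0 + p 1 • P 1 = p 2 • P 2 + p 3 • P 3)
    (q : Fin 4 → ℝ) (hq : ∀ i, 0 ≤ q i)
    (hqeq : q 0 • P 0 + q 1 • P 1 = q 2 • P 2 + q 3 • P 3) :
    ∃ α : ℝ, 0 ≤ α ∧ ∀ i, q i = α * p i := by
  obtain ⟨α, hα⟩ : ∃ α : ℝ, α = q 0 / p 0 := ⟨_, rfl⟩
  have h0 : q 0 = α * p 0 := by rw [hα, div_mul_cancel₀ _ (hp 0).ne']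
  have hrel : (q 1 - α * p 1) • P 1 + (α * p 2 - q 2) • P 2 + (α * p 3 - q 3) • P 3 = 0 := by
    have hdiff : (q 0 • P 0 + q 1 • P 1 - (q 2 • P 2 + q 3 • P 3))
        - α • (p 0 • P 0 + p 1 • P 1 - (p 2 • P 2 + p 3 • P 3)) = 0 := by
      rw [hpeq, hqeq, sub_self, sub_self, smul_zero, sub_zero]
    rw [← hdiff, h0]
    module
  have h12 := hdist 1 2 (by decide)
  have h13 := hdist 1 3 (by decide)
  have h23 := hdist 2 3 (by decide)
  have h1 := (hproj 1).coeff_eq_zero (hproj 2) (hproj 3) h12 h13 h23 hrel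
  have h2 := (hproj 2).coeff_eq_zero (hproj 3) (hproj 1) h23 h12.symm h13.symm
    (by rw [← hrel]; abel)
  have h3 := (hproj 3).coeff_eq_zero (hproj 1) (hproj 2) h13.symm h23.symm h12
    (by rw [← hrel]; abel)
  refine ⟨α, hα ▸ div_nonneg (hq 0) (hp 0).le, fun i => ?_⟩
  fin_cases i
  · exact h0
  · exact sub_eq_zero.mp h1
  · exact (sub_eq_zero.mp h2).symm
  · exact (sub_eq_zero.mp h3).symm
end

section
/- Let P₁, P₂, P₃, P₄ be rank-one orthogonal projections on ℂ^d with P₁ ≠ P₂, and let p₁, p₂ > 0 and p₃, p₄ ≥ 0 satisfy p₁P₁ + p₂P₂ = p₃P₃ + p₄P₄. Then p₃ > 0 and p₄ > 0, and exactly one of the following holds: (a) P₃ = P₁, P₄ = P₂, p₃ = p₁ and p₄ = p₂, or P₃ = P₂, P₄ = P₁, p₃ = p₂ and p₄ = p₁; (b) P₁, P₂, P₃, P₄ are pairwise distinct. -/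
open scoped Classical Matrix

namespace IsRankOneProj

variable {d : ℕ} {P Q R S : Matrix (Fin d) (Fin d) ℂ}

theorem trace_eq_one_s6 (h : IsRankOneProj P) : P.trace = 1 := by
  obtain ⟨-, hi, hr⟩ := h
  have hidem : IsIdempotentElem (Matrix.toLin' P) := by
    rw [IsIdempotentElem, Module.End.mul_eq_comp, ← Matrix.toLin'_mul, hi]
  have htr := (LinearMap.IsIdempotentElem.isProj_range _ hidem).trace
  have hrange : Module.finrank ℂ (Matrix.toLin' P).range = 1 := hr
  rwa [Matrix.trace_toLin'_eq, hrange, Nat.cast_one] at htr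

open scoped ComplexOrder in
theorem eq_of_trace_mul_eq_one (hP : IsRankOneProj P) (hQ : IsRankOneProj Q)
    (h : (P * Q).trace = 1) : P = Q := by
  rw [← sub_eq_zero, ← Matrix.trace_conjTranspose_mul_self_eq_zero_iff,
    Matrix.conjTranspose_sub, hP.1.eq, hQ.1.eq, sub_mul, mul_sub, mul_sub, hP.2.1, hQ.2.1]
  simp only [Matrix.trace_sub, Matrix.trace_mul_comm Q P, h, hP.trace_eq_one_s6, hQ.trace_eq_one_s6]
  norm_num

/-- A rank-one projection is extreme: it is not a positive combination of two distinct ones. -/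
theorem eq_of_smul_add_smul_eq_smul (hP : IsRankOneProj P) (hQ : IsRankOneProj Q)
    (hR : IsRankOneProj R) {a b c : ℝ} (ha : 0 < a) (hb : 0 < b)
    (h : a • P + b • Q = c • R) : P = Q := by
  have ht := congrArg Matrix.trace h
  have hs := congrArg (fun M => (M * M).trace) h
  simp only [add_mul, mul_add, smul_mul_assoc, mul_smul_comm, Matrix.trace_add,
    Matrix.trace_smul, hP.2.1, hQ.2.1, hR.2.1, hP.trace_eq_one_s6, hQ.trace_eq_one_s6,
    hR.trace_eq_one_s6, Matrix.trace_mul_comm Q P, Complex.real_smul, mul_one] at ht hs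
  apply eq_of_trace_mul_eq_one hP hQ
  have ha' : (a : ℂ) ≠ 0 := by exact_mod_cast ha.ne'
  have hb' : (b : ℂ) ≠ 0 := by exact_mod_cast hb.ne'
  apply mul_left_cancel₀ (mul_ne_zero (mul_ne_zero two_ne_zero ha') hb')
  rw [← ht] at hs
  linear_combination hs

theorem eq_of_smul_eq_smul (hP : IsRankOneProj P) (hQ : IsRankOneProj Q) {a b : ℝ}
    (ha : 0 < a) (h : a • P = b • Q) : P = Q ∧ a = b := by
  have ht := congrArg Matrix.trace h
  simp only [Matrix.trace_smul, hP.trace_eq_one_s6, hQ.trace_eq_one_s6, Complex.real_smul, mul_one,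
    Complex.ofReal_inj] at ht
  subst ht
  exact ⟨smul_right_injective _ ha.ne' h, rfl⟩

theorem eq_of_smul_add_smul_eq_of_ne (hP : IsRankOneProj P) (hQ : IsRankOneProj Q)
    (hS : IsRankOneProj S) (hPQ : P ≠ Q) {a b c e : ℝ} (hb : 0 < b) (he : 0 < e)
    (h : a • P + b • Q = c • P + e • S) : S = Q ∧ c = a ∧ e = b := by
  rcases lt_trichotomy a c with hac | rfl | hac
  · have h' : (c - a) • P + e • S = b • Q := by
      rw [sub_smul, sub_add_eq_add_sub, ← h, add_sub_cancel_left]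
    obtain rfl := eq_of_smul_add_smul_eq_smul hP hS hQ (sub_pos.2 hac) he h'
    rw [← add_smul] at h'
    exact absurd (eq_of_smul_eq_smul hQ hP hb h'.symm).1.symm hPQ
  · obtain ⟨h₁, h₂⟩ := eq_of_smul_eq_smul hQ hS hb (add_left_cancel h)
    exact ⟨h₁.symm, rfl, h₂.symm⟩
  · have h' : (a - c) • P + b • Q = e • S := by
      rw [sub_smul, sub_add_eq_add_sub, h, add_sub_cancel_left]
    exact absurd (eq_of_smul_add_smul_eq_smul hP hQ hS (sub_pos.2 hac) hb h') hPQ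

end IsRankOneProj

/-- If `p₁P₁ + p₂P₂ = p₃P₃ + p₄P₄` with rank-one projections, `P₁ ≠ P₂`, `p₁, p₂ > 0` and
`p₃, p₄ ≥ 0`, then `p₃, p₄ > 0`, and exactly one of the following holds: (a) `{P₃, P₄}`
matches `{P₁, P₂}` with matching weights, or (b) `P₁, P₂, P₃, P₄` are pairwise distinct. -/
theorem two_decompositions_dichotomy (d : ℕ)
    (P₁ P₂ P₃ P₄ : Matrix (Fin d) (Fin d) ℂ)
    (h₁ : IsRankOneProj P₁) (h₂ : IsRankOneProj P₂)
    (h₃ : IsRankOneProj P₃) (h₄ : IsRankOneProj P₄)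
    (h12 : P₁ ≠ P₂)
    (p₁ p₂ p₃ p₄ : ℝ) (hp₁ : 0 < p₁) (hp₂ : 0 < p₂) (hp₃ : 0 ≤ p₃) (hp₄ : 0 ≤ p₄)
    (heq : p₁ • P₁ + p₂ • P₂ = p₃ • P₃ + p₄ • P₄) :
    0 < p₃ ∧ 0 < p₄ ∧
    Xor'
      ((P₃ = P₁ ∧ P₄ = P₂ ∧ p₃ = p₁ ∧ p₄ = p₂) ∨
        (P₃ = P₂ ∧ P₄ = P₁ ∧ p₃ = p₂ ∧ p₄ = p₁))
      (P₁ ≠ P₂ ∧ P₁ ≠ P₃ ∧ P₁ ≠ P₄ ∧ P₂ ≠ P₃ ∧ P₂ ≠ P₄ ∧ P₃ ≠ P₄) := by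
  have hp₃' : 0 < p₃ := hp₃.lt_of_ne fun h => h12 <|
    h₁.eq_of_smul_add_smul_eq_smul h₂ h₄ hp₁ hp₂ (c := p₄) (by rw [heq, ← h, zero_smul, zero_add])
  have hp₄' : 0 < p₄ := hp₄.lt_of_ne fun h => h12 <|
    h₁.eq_of_smul_add_smul_eq_smul h₂ h₃ hp₁ hp₂ (c := p₃) (by rw [heq, ← h, zero_smul, add_zero])
  have h34 : P₃ ≠ P₄ := fun h => h12 <|
    h₁.eq_of_smul_add_smul_eq_smul h₂ h₃ hp₁ hp₂ (c := p₃ + p₄) (by rw [heq, ← h, add_smul])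
  refine ⟨hp₃', hp₄', ?_⟩
  by_cases h13 : P₁ = P₃
  · subst h13
    obtain ⟨hP, hp, hq⟩ := h₁.eq_of_smul_add_smul_eq_of_ne h₂ h₄ h12 hp₂ hp₄' heq
    exact Or.inl ⟨Or.inl ⟨rfl, hP, hp, hq⟩, fun h => h.2.1 rfl⟩
  by_cases h14 : P₁ = P₄
  · subst h14
    obtain ⟨hP, hp, hq⟩ := h₁.eq_of_smul_add_smul_eq_of_ne h₂ h₃ h12 hp₂ hp₃'
      (heq.trans (add_comm _ _))
    exact Or.inl ⟨Or.inr ⟨hP, rfl, hq, hp⟩, fun h => h.2.2.1 rfl⟩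
  by_cases h23 : P₂ = P₃
  · subst h23
    exact absurd (h₂.eq_of_smul_add_smul_eq_of_ne h₁ h₄ h12.symm hp₁ hp₄'
      ((add_comm _ _).trans heq)).1.symm h14
  by_cases h24 : P₂ = P₄
  · subst h24
    exact absurd (h₂.eq_of_smul_add_smul_eq_of_ne h₁ h₃ h12.symm hp₁ hp₃'
      ((add_comm _ _).trans (heq.trans (add_comm _ _)))).1.symm h13
  refine Or.inr ⟨⟨h12, h13, h14, h23, h24, h34⟩, ?_⟩
  rintro (⟨h, -⟩ | ⟨h, -⟩)
  · exact h13 h.symm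
  · exact h23 h.symm
end

section
/- Let ψ ∈ ℂ^{dA}⊗ℂ^{dB}⊗ℂ^{dC} be a unit vector. Then ψ is genuinely three-party entangled if and only if there exist vectors φ_a ∈ ℂ^{dA} and φ_b ∈ ℂ^{dB} such that the contraction of φ_a against the first factor of ψ is an entangled vector in ℂ^{dB}⊗ℂ^{dC} and the contraction of φ_b against the second factor of ψ is an entangled vector in ℂ^{dA}⊗ℂ^{dC}. -/
open scoped Classical

/-- Unit vector (with respect to the ℓ² norm). -/
def UnitVec {ι : Type*} [Fintype ι] (v : ι → ℂ) : Prop :=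
  ∑ p, Complex.normSq (v p) = 1

/-- Product vector in `ℂ^m ⊗ ℂ^n`. -/
def IsProdVec {m n : ℕ} (v : Fin m × Fin n → ℂ) : Prop :=
  ∃ (u : Fin m → ℂ) (w : Fin n → ℂ), ∀ j k, v (j, k) = u j * w k

/-- Entangled vector in `ℂ^m ⊗ ℂ^n`. -/
def IsEntangled {m n : ℕ} (v : Fin m × Fin n → ℂ) : Prop := v ≠ 0 ∧ ¬ IsProdVec v

/-- Genuinely three-party entangled vector: not a product vector across any of the three
bipartite splittings `(A|BC)`, `(B|AC)`, `(AB|C)`. -/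
def GenuinelyEntangled {dA dB dC : ℕ} (ψ : Fin dA × Fin dB × Fin dC → ℂ) : Prop :=
  (¬ ∃ (u : Fin dA → ℂ) (w : Fin dB × Fin dC → ℂ), ∀ i j k, ψ (i, j, k) = u i * w (j, k)) ∧
  (¬ ∃ (u : Fin dB → ℂ) (w : Fin dA × Fin dC → ℂ), ∀ i j k, ψ (i, j, k) = u j * w (i, k)) ∧
  (¬ ∃ (u : Fin dA × Fin dB → ℂ) (w : Fin dC → ℂ), ∀ i j k, ψ (i, j, k) = u (i, j) * w k)

/-- Contraction of `φ` against the first tensor factor of `ψ`. -/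
noncomputable def contractA {dA dB dC : ℕ} (φ : Fin dA → ℂ)
    (ψ : Fin dA × Fin dB × Fin dC → ℂ) : Fin dB × Fin dC → ℂ :=
  fun p => ∑ i, (starRingEnd ℂ) (φ i) * ψ (i, p.1, p.2)

/-- Contraction of `φ` against the second tensor factor of `ψ`. -/
noncomputable def contractB {dA dB dC : ℕ} (φ : Fin dB → ℂ)
    (ψ : Fin dA × Fin dB × Fin dC → ℂ) : Fin dA × Fin dC → ℂ :=
  fun p => ∑ j, (starRingEnd ℂ) (φ j) * ψ (p.1, j, p.2)

/-- A family of matrices all of whose linear combinations have rank at most one shares a common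
column vector or a common row vector. -/
theorem common_factor_of_forall_sum_eq_mul {K ι α β : Type*} [Field K] [Fintype ι]
    (F : ι → α → β → K)
    (hF : ∀ c : ι → K, ∃ (u : α → K) (w : β → K), ∀ j k, ∑ i, c i * F i j k = u j * w k) :
    (∃ (u : α → K) (y : ι → β → K), ∀ i j k, F i j k = u j * y i k) ∨
      (∃ (x : ι → α → K) (w : β → K), ∀ i j k, F i j k = x i j * w k) := by
  have single : ∀ a, ∃ (u : α → K) (w : β → K), ∀ j k, F a j k = u j * w k := fun a => by
    obtain ⟨u, w, h⟩ := hF (Pi.single a 1)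
    exact ⟨u, w, fun j k => by simpa [Pi.single_apply] using h j k⟩
  choose u w huw using single
  have pair : ∀ a b, (∀ j j', u a j * u b j' = u b j * u a j') ∨
      (∀ k k', w a k * w b k' = w b k * w a k') := fun a b => by
    obtain ⟨p, q, h⟩ := hF (Pi.single a 1 + Pi.single b 1)
    have h' : ∀ j k, u a j * w a k + u b j * w b k = p j * q k := fun j k => by
      simpa [Pi.single_apply, add_mul, Finset.sum_add_distrib, huw] using h j k
    by_contra! hne
    obtain ⟨⟨j, j', hj⟩, k, k', hk⟩ := hne
    refine mul_ne_zero (sub_ne_zero.2 hj) (sub_ne_zero.2 hk) ?_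
    linear_combination (u a j' * w a k' + u b j' * w b k') * h' j k + p j * q k * h' j' k' -
      (u a j' * w a k + u b j' * w b k) * h' j k' - p j * q k' * h' j' k
  by_cases hzero : ∀ a j k, F a j k = 0
  · exact Or.inl ⟨0, 0, fun a j k => by simp [hzero]⟩
  push Not at hzero
  obtain ⟨a, j₀, k₀, ha⟩ := hzero
  rw [huw] at ha
  have hu := left_ne_zero_of_mul ha
  have hw := right_ne_zero_of_mul ha
  by_cases hQ : ∀ b, ∃ y : β → K, ∀ j k, F b j k = u a j * y k
  · choose y hy using hQ
    exact Or.inl ⟨u a, y, hy⟩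
  by_cases hR : ∀ b, ∃ x : α → K, ∀ j k, F b j k = x j * w a k
  · choose x hx using hR
    exact Or.inr ⟨x, w a, hx⟩
  exfalso
  push Not at hQ hR
  obtain ⟨b, hb⟩ := hQ
  obtain ⟨c, hc⟩ := hR
  have hnu : ∀ t : K, ¬ ∀ j, u b j = t * u a j := fun t ht => by
    obtain ⟨j, k, h⟩ := hb fun k => t * w b k
    exact h (by rw [huw, ht]; ring)
  have hnw : ∀ t : K, ¬ ∀ k, w c k = t * w a k := fun t ht => by
    obtain ⟨j, k, h⟩ := hc fun j => t * u c j
    exact h (by rw [huw, ht]; ring)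
  have hwb : ∀ k, w b k = w b k₀ / w a k₀ * w a k := by
    rcases pair a b with h | h
    · exact (hnu (u b j₀ / u a j₀) fun j => by field_simp; linear_combination h j₀ j).elim
    · intro k
      field_simp
      linear_combination h k₀ k
  have huc : ∀ j, u c j = u c j₀ / u a j₀ * u a j := by
    rcases pair a c with h | h
    · intro j
      field_simp
      linear_combination h j₀ j
    · exact (hnw (w c k₀ / w a k₀) fun k => by field_simp; linear_combination h k₀ k).elim
  have hwb₀ : w b k₀ ≠ 0 := fun h0 => by
    obtain ⟨j, k, h⟩ := hb 0
    exact h (by rw [huw, hwb, h0]; simp)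
  have huc₀ : u c j₀ ≠ 0 := fun h0 => by
    obtain ⟨j, k, h⟩ := hc 0
    exact h (by rw [huw, huc, h0]; simp)
  rcases pair b c with h | h
  · refine hnu (u b j₀ / u a j₀) fun j => ?_
    have e := h j j₀
    rw [huc j] at e
    field_simp at e ⊢
    linear_combination e
  · refine hnw (w c k₀ / w a k₀) fun k => ?_
    have e := h k₀ k
    rw [hwb k₀] at e
    have e' := hwb k
    rw [e'] at e
    field_simp at e ⊢
    linear_combination e

/-- A vector that is not entangled is a product vector. -/
theorem isProdVec_of_not_isEntangled {m n : ℕ} {v : Fin m × Fin n → ℂ}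
    (h : ¬ IsEntangled v) : IsProdVec v := by
  by_contra hp
  refine h ⟨?_, hp⟩
  rintro rfl
  exact hp ⟨0, 0, by simp⟩

/-- A unit vector `ψ ∈ ℂ^{dA} ⊗ ℂ^{dB} ⊗ ℂ^{dC}` is genuinely three-party entangled iff some
contraction against the first factor and some contraction against the second factor are
entangled. -/
theorem genuinelyEntangled_iff_entangled_contractions
    (dA dB dC : ℕ) (ψ : Fin dA × Fin dB × Fin dC → ℂ) (hunit : UnitVec ψ) :
    GenuinelyEntangled ψ ↔
      ∃ (φa : Fin dA → ℂ) (φb : Fin dB → ℂ),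
        IsEntangled (contractA φa ψ) ∧ IsEntangled (contractB φb ψ) := by
  constructor
  · rintro ⟨hA, hB, hC⟩
    have exA : ∃ φ, IsEntangled (contractA φ ψ) := by
      by_contra! hno
      rcases common_factor_of_forall_sum_eq_mul (fun i j k => ψ (i, j, k)) fun c => by
          simpa [IsProdVec, contractA] using
            isProdVec_of_not_isEntangled (hno fun i => starRingEnd ℂ (c i))
        with ⟨u, y, h⟩ | ⟨x, w, h⟩
      · exact hB ⟨u, fun p => y p.1 p.2, h⟩
      · exact hC ⟨fun p => x p.1 p.2, w, h⟩
    have exB : ∃ φ, IsEntangled (contractB φ ψ) := by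
      by_contra! hno
      rcases common_factor_of_forall_sum_eq_mul (fun j i k => ψ (i, j, k)) fun c => by
          simpa [IsProdVec, contractB] using
            isProdVec_of_not_isEntangled (hno fun j => starRingEnd ℂ (c j))
        with ⟨u, y, h⟩ | ⟨x, w, h⟩
      · exact hA ⟨u, fun p => y p.1 p.2, fun i j k => h j i k⟩
      · exact hC ⟨fun p => x p.2 p.1, w, fun i j k => h j i k⟩
    obtain ⟨φa, ha⟩ := exA
    obtain ⟨φb, hb⟩ := exB
    exact ⟨φa, φb, ha, hb⟩
  · rintro ⟨φa, φb, ⟨-, ha⟩, -, hb⟩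
    refine ⟨?_, ?_, ?_⟩
    · rintro ⟨u, w, h⟩
      refine hb ⟨u, fun k => ∑ j, (starRingEnd ℂ) (φb j) * w (j, k), fun i k => ?_⟩
      simp only [contractB, h, Finset.mul_sum]
      exact Finset.sum_congr rfl fun _ _ => by ring
    · rintro ⟨u, w, h⟩
      refine ha ⟨u, fun k => ∑ i, (starRingEnd ℂ) (φa i) * w (i, k), fun j k => ?_⟩
      simp only [contractA, h, Finset.mul_sum]
      exact Finset.sum_congr rfl fun _ _ => by ring
    · rintro ⟨u, w, h⟩
      refine ha ⟨fun j => ∑ i, (starRingEnd ℂ) (φa i) * u (i, j), w, fun j k => ?_⟩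
      simp only [contractA, h, Finset.sum_mul]
      exact Finset.sum_congr rfl fun _ _ => by ring
end

section
/- Let ψ ∈ ℂ²⊗ℂ²⊗ℂ^d be a unit vector that is not a product vector across the splitting (A|BC), and suppose there exists φ ∈ ℂ² whose contraction against the first factor of ψ is an entangled vector in ℂ²⊗ℂ^d. Then there exists an orthonormal basis (φ₁, φ₂) of ℂ² such that the contractions ψ_i of φ_i against the first factor of ψ (i = 1,2) are both entangled vectors in ℂ²⊗ℂ^d and are linearly independent. -/
open scoped Classical

/-- A vector of `ℂ² ⊗ ℂⁿ` that is not a product vector has a nonvanishing `2 × 2` minor. -/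
theorem exists_minor_ne_zero_of_not_isProdVec {n : ℕ} {v : Fin 2 × Fin n → ℂ}
    (hv : ¬ IsProdVec v) : ∃ k l, v (0, k) * v (1, l) - v (0, l) * v (1, k) ≠ 0 := by
  by_contra! h
  apply hv
  by_cases h0 : ∀ k, v (0, k) = 0
  · refine ⟨![0, 1], fun k => v (1, k), fun j k => ?_⟩
    fin_cases j <;> simp [h0]
  · push Not at h0
    obtain ⟨k₀, hk₀⟩ := h0
    refine ⟨![1, v (1, k₀) / v (0, k₀)], fun k => v (0, k), fun j k => ?_⟩
    fin_cases j
    · simp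
    · have := h k₀ k
      simp only [Fin.mk_one, Matrix.cons_val_one, Matrix.cons_val_fin_one]
      field_simp
      linear_combination this

/-- A vector of `ℂ² ⊗ ℂⁿ` with a nonvanishing `2 × 2` minor is entangled. -/
theorem isEntangled_of_minor_ne_zero {n : ℕ} {v : Fin 2 × Fin n → ℂ} {k l : Fin n}
    (h : v (0, k) * v (1, l) - v (0, l) * v (1, k) ≠ 0) : IsEntangled v := by
  refine ⟨?_, ?_⟩
  · rintro rfl
    simp at h
  · rintro ⟨u, w, huw⟩
    apply h
    simp only [huw]
    ring

/-- A nonzero binary quadratic form over `ℂ` is nonzero on both vectors of some real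
orthonormal basis of `ℂ²`. -/
theorem exists_real_rotation_quadratic_ne_zero {α β γ : ℂ} (h : ¬ (α = 0 ∧ β = 0 ∧ γ = 0)) :
    ∃ x y : ℝ, x * x + y * y = 1 ∧ α * x ^ 2 + β * (x * y) + γ * y ^ 2 ≠ 0 ∧
      α * y ^ 2 - β * (x * y) + γ * x ^ 2 ≠ 0 := by
  open Polynomial in
  have key : ∀ a b c : ℂ, ¬ (a = 0 ∧ b = 0 ∧ c = 0) → (C a + C b * X + C c * X ^ 2 : ℂ[X]) ≠ 0 := by
    intro a b c habc h0
    refine habc ⟨?_, ?_, ?_⟩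
    · simpa [coeff_X, coeff_C] using congrArg (coeff · 0) h0
    · simpa [coeff_X, coeff_C, coeff_X_pow] using congrArg (coeff · 1) h0
    · simpa [coeff_X, coeff_C, coeff_X_pow] using congrArg (coeff · 2) h0
  have hne := mul_ne_zero (key α β γ h) (key γ (-β) α (by simpa [and_comm, and_left_comm] using h))
  obtain ⟨t, ht⟩ : ∃ t : ℝ, (α + β * t + γ * t ^ 2) * (γ + -β * t + α * t ^ 2) ≠ 0 := by
    by_contra! hroot
    refine hne (Polynomial.eq_zero_of_infinite_isRoot _
      ((Set.infinite_range_of_injective Complex.ofReal_injective).mono ?_))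
    rintro _ ⟨t, rfl⟩
    simpa [Polynomial.IsRoot] using hroot t
  obtain ⟨ht₁, ht₂⟩ := mul_ne_zero_iff.1 ht
  have hpos : 0 < 1 + t ^ 2 := by positivity
  have hr : (√(1 + t ^ 2))⁻¹ ^ 2 * (1 + t ^ 2) = 1 := by
    rw [inv_pow, Real.sq_sqrt hpos.le, inv_mul_cancel₀ hpos.ne']
  have hr0 : (((√(1 + t ^ 2))⁻¹ : ℝ) : ℂ) ^ 2 ≠ 0 := by
    have : (√(1 + t ^ 2))⁻¹ ≠ 0 := by positivity
    exact pow_ne_zero _ (Complex.ofReal_ne_zero.2 this)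
  generalize (√(1 + t ^ 2))⁻¹ = r at hr hr0
  refine ⟨r, r * t, by linear_combination hr, ?_, ?_⟩
  · convert mul_ne_zero hr0 ht₁ using 1
    push_cast
    ring
  · convert mul_ne_zero hr0 ht₂ using 1
    push_cast
    ring

/-- The two slices of a vector entangled across `(A|BC)` are linearly independent. -/
theorem slices_independent {dB dC : ℕ} {ψ : Fin 2 × Fin dB × Fin dC → ℂ}
    (hA : ¬ ∃ (u : Fin 2 → ℂ) (w : Fin dB × Fin dC → ℂ), ∀ i j k, ψ (i, j, k) = u i * w (j, k))
    {a b : ℂ} (h : ∀ j k, a * ψ (0, j, k) + b * ψ (1, j, k) = 0) : a = 0 ∧ b = 0 := by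
  by_contra hab
  apply hA
  by_cases ha : a = 0
  · have hb : b ≠ 0 := fun hb => hab ⟨ha, hb⟩
    refine ⟨![1, 0], fun p => ψ (0, p), fun i j k => ?_⟩
    fin_cases i
    · simp
    · simpa [ha, hb] using h j k
  · refine ⟨![-b / a, 1], fun p => ψ (1, p), fun i j k => ?_⟩
    fin_cases i
    · simp only [Fin.zero_eta, Matrix.cons_val_zero]
      field_simp
      linear_combination h j k
    · simp

/-- For a unit vector `ψ ∈ ℂ² ⊗ ℂ² ⊗ ℂ^d` entangled across `(A|BC)` admitting one entangled
contraction on the first factor, there is an orthonormal basis of the first qubit whose two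
contractions against `ψ` are entangled and linearly independent. -/
theorem exists_basis_entangled_linearIndependent_contractions
    (d : ℕ) (ψ : Fin 2 × Fin 2 × Fin d → ℂ) (hunit : UnitVec ψ)
    (hA : ¬ ∃ (u : Fin 2 → ℂ) (w : Fin 2 × Fin d → ℂ), ∀ i j k, ψ (i, j, k) = u i * w (j, k))
    (hφ : ∃ φ : Fin 2 → ℂ, IsEntangled (contractA φ ψ)) :
    ∃ φ : Fin 2 → Fin 2 → ℂ,
      (∀ i j, ∑ k, (starRingEnd ℂ) (φ i k) * φ j k = if i = j then 1 else 0) ∧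
      (∀ i, IsEntangled (contractA (φ i) ψ)) ∧
      LinearIndependent ℂ (fun i : Fin 2 => contractA (φ i) ψ) := by
  obtain ⟨φ, -, hprod⟩ := hφ
  obtain ⟨k, l, hkl⟩ := exists_minor_ne_zero_of_not_isProdVec hprod
  obtain ⟨x, y, hxy, h₁, h₂⟩ := exists_real_rotation_quadratic_ne_zero
    (α := ψ (0, 0, k) * ψ (0, 1, l) - ψ (0, 0, l) * ψ (0, 1, k))
    (β := ψ (0, 0, k) * ψ (1, 1, l) + ψ (1, 0, k) * ψ (0, 1, l)
      - ψ (0, 0, l) * ψ (1, 1, k) - ψ (1, 0, l) * ψ (0, 1, k))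
    (γ := ψ (1, 0, k) * ψ (1, 1, l) - ψ (1, 0, l) * ψ (1, 1, k)) (by
      rintro ⟨hα, hβ, hγ⟩
      apply hkl
      simp only [contractA, Fin.sum_univ_two]
      linear_combination (starRingEnd ℂ (φ 0)) ^ 2 * hα
        + starRingEnd ℂ (φ 0) * starRingEnd ℂ (φ 1) * hβ + (starRingEnd ℂ (φ 1)) ^ 2 * hγ)
  have hxyC : (x : ℂ) * x + y * y = 1 := mod_cast hxy
  refine ⟨![![x, y], ![-y, x]], ?_, ?_, ?_⟩
  · intro i j
    fin_cases i <;> fin_cases j <;> simp [Fin.sum_univ_two] <;>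
      first | ring1 | linear_combination hxyC
  · intro i
    apply isEntangled_of_minor_ne_zero (k := k) (l := l)
    fin_cases i
    · convert h₁ using 1
      simp [contractA, Fin.sum_univ_two]
      ring
    · convert h₂ using 1
      simp [contractA, Fin.sum_univ_two]
      ring
  · rw [Fintype.linearIndependent_iff]
    intro c hc
    obtain ⟨ha, hb⟩ := slices_independent hA (a := c 0 * x - c 1 * y) (b := c 0 * y + c 1 * x) (by
      intro j k
      have := congrFun hc (j, k)
      simp [contractA, Fin.sum_univ_two] at this
      linear_combination this)
    rw [Fin.forall_fin_two]
    constructor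
    · linear_combination x * ha + y * hb - c 0 * hxyC
    · linear_combination x * hb - y * ha - c 1 * hxyC
end

section
/- Let φ₁, φ₂ ∈ ℂ²⊗ℂ^d be entangled vectors and let P_{a|x} (a,x ∈ {0,1}) be two two-outcome PVMs on ℂ² (orthogonal projections with P_{0|x}+P_{1|x}=I for x = 0,1) such that P_{0|0} and P_{0|1} do not commute. For j ∈ {1,2} set σ^{(j)}_{a|x} = Tr_A((P_{a|x}⊗I)|φ_j⟩⟨φ_j|). Then for each j the four matrices σ^{(j)}_{0|0}, σ^{(j)}_{1|0}, σ^{(j)}_{0|1}, σ^{(j)}_{1|1} are nonzero, of rank one, and no one of them is a complex scalar multiple of another. Moreover, φ₁ and φ₂ are linearly dependent if and only if for every (a,x) the matrix σ^{(1)}_{a|x} is a nonzero scalar multiple of σ^{(2)}_{a|x}. -/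
open scoped Classical

/-- Outer product |v⟩⟨v|. -/
noncomputable def outer {ι : Type*} (v : ι → ℂ) : Matrix ι ι ℂ := fun p q => v p * star (v q)

/-- A pair (indexed by `x`) of two-outcome PVMs on `ℂ^m`. -/
def IsPVM2 {m : ℕ} (P : Fin 2 → Fin 2 → Matrix (Fin m) (Fin m) ℂ) : Prop :=
  (∀ a x, (P a x).IsHermitian) ∧ (∀ a x, P a x * P a x = P a x) ∧
  (∀ x, P 0 x + P 1 x = 1)

/-- The operator `A ⊗ I` on `ℂ^m ⊗ ℂ^d`. -/
noncomputable def tensI {m : ℕ} (d : ℕ) (A : Matrix (Fin m) (Fin m) ℂ) :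
    Matrix (Fin m × Fin d) (Fin m × Fin d) ℂ :=
  fun p q => A p.1 q.1 * (if p.2 = q.2 then 1 else 0)

/-- Partial trace over the first tensor factor. -/
noncomputable def ptraceA {m d : ℕ} (M : Matrix (Fin m × Fin d) (Fin m × Fin d) ℂ) :
    Matrix (Fin d) (Fin d) ℂ :=
  fun u v => ∑ k : Fin m, M (k, u) (k, v)

/-- The (subnormalised) assemblage `σ_{a|x} = Tr_A((P_{a|x} ⊗ I)|φ⟩⟨φ|)`. -/
noncomputable def sigOf {d : ℕ} (φ : Fin 2 × Fin d → ℂ)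
    (P : Fin 2 → Fin 2 → Matrix (Fin 2) (Fin 2) ℂ) (a x : Fin 2) :
    Matrix (Fin d) (Fin d) ℂ :=
  ptraceA (tensI d (P a x) * outer φ)

/-- The `d × m` coefficient matrix of a vector in `ℂ^m ⊗ ℂ^d`. -/
def coeffMatrix {m d : ℕ} (φ : Fin m × Fin d → ℂ) : Matrix (Fin d) (Fin m) ℂ :=
  Matrix.of fun u l => φ (l, u)

section Auxiliary

open Matrix

theorem sigOf_eq_mul {d : ℕ} (φ : Fin 2 × Fin d → ℂ)
    (P : Fin 2 → Fin 2 → Matrix (Fin 2) (Fin 2) ℂ) (a x : Fin 2) :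
    sigOf φ P a x = coeffMatrix φ * (P a x)ᵀ * (coeffMatrix φ)ᴴ := by
  ext u v
  simp only [sigOf, ptraceA, tensI, outer, coeffMatrix, Matrix.mul_apply, Fintype.sum_prod_type,
    Fin.sum_univ_two, mul_ite, mul_one, mul_zero, ite_mul, zero_mul, Finset.sum_ite_eq,
    Finset.mem_univ, if_true, Matrix.transpose_apply, Matrix.conjTranspose_apply, Matrix.of_apply]
  ring

/-- The coefficient matrix of an entangled vector in `ℂ² ⊗ ℂ^d` has a nonzero `2 × 2` minor. -/
theorem IsEntangled.exists_minor_ne_zero {d : ℕ} {φ : Fin 2 × Fin d → ℂ} (h : IsEntangled φ) :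
    ∃ u v, φ (0, u) * φ (1, v) - φ (1, u) * φ (0, v) ≠ 0 := by
  by_contra! H
  obtain ⟨⟨i₀, k₀⟩, hne⟩ := Function.ne_iff.mp h.1
  have hne' : φ (i₀, k₀) ≠ 0 := hne
  refine h.2 ⟨fun j => φ (j, k₀) / φ (i₀, k₀), fun k => φ (i₀, k), fun j k => ?_⟩
  have hminor := H k₀ k
  field_simp
  fin_cases i₀ <;> fin_cases j <;> simp only [Fin.zero_eta, Fin.mk_one] at * <;>
    grind

theorem IsEntangled.exists_leftInverse {d : ℕ} {φ : Fin 2 × Fin d → ℂ} (h : IsEntangled φ) :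
    ∃ L : Matrix (Fin 2) (Fin d) ℂ, L * coeffMatrix φ = 1 := by
  obtain ⟨u, v, huv⟩ := h.exists_minor_ne_zero
  set S := (coeffMatrix φ).submatrix ![u, v] id with hS
  have hdet : IsUnit S.det := by
    rw [isUnit_iff_ne_zero, Matrix.det_fin_two]
    exact huv
  refine ⟨S⁻¹ * (1 : Matrix (Fin d) (Fin d) ℂ).submatrix ![u, v] id, ?_⟩
  have hsel (e : Fin 2 → Fin d) : (1 : Matrix (Fin d) (Fin d) ℂ).submatrix e id * coeffMatrix φ =
      (coeffMatrix φ).submatrix e id := by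
    ext i j
    simp [Matrix.mul_apply, Matrix.one_apply]
  rw [Matrix.mul_assoc, hsel, ← hS, Matrix.nonsing_inv_mul _ hdet]

section LeftInverse

variable {m n : Type*} [Fintype m] [Fintype n] [DecidableEq m]
  {L : Matrix m n ℂ} {M : Matrix n m ℂ}

theorem leftInverse_conj (hL : L * M = 1) (A : Matrix m m ℂ) :
    L * (M * A * Mᴴ) * Lᴴ = A := by
  have hL' : Mᴴ * Lᴴ = 1 := by rw [← conjTranspose_mul, hL, conjTranspose_one]
  calc L * (M * A * Mᴴ) * Lᴴ = (L * M) * A * (Mᴴ * Lᴴ) := by simp only [Matrix.mul_assoc]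
    _ = A := by rw [hL, hL', Matrix.one_mul, Matrix.mul_one]

theorem conj_injective_of_leftInverse (hL : L * M = 1) :
    Function.Injective fun A : Matrix m m ℂ => M * A * Mᴴ := fun A B hAB => by
  rw [← leftInverse_conj hL A, ← leftInverse_conj hL B]
  exact congrArg (fun X => L * X * Lᴴ) hAB

theorem rank_conj_of_leftInverse (hL : L * M = 1) (A : Matrix m m ℂ) :
    (M * A * Mᴴ).rank = A.rank := by
  apply le_antisymm
  · exact (rank_mul_le_left _ _).trans (rank_mul_le_right _ _)
  · conv_lhs => rw [← leftInverse_conj hL A]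
    exact (rank_mul_le_left _ _).trans (rank_mul_le_right _ _)

end LeftInverse

theorem rank_pos_of_ne_zero {m n : Type*} [Fintype n] [Finite m] {A : Matrix m n ℂ}
    (hA : A ≠ 0) : 0 < A.rank := by
  classical
  rw [Nat.pos_iff_ne_zero]
  intro h0
  apply hA
  rw [Matrix.rank, Submodule.finrank_eq_zero, LinearMap.range_eq_bot] at h0
  ext i j
  have := congrFun (LinearMap.congr_fun h0 (Pi.single j 1)) i
  simpa using this

theorem rank_eq_one_of_idempotent {P : Matrix (Fin 2) (Fin 2) ℂ} (hP : P * P = P)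
    (h0 : P ≠ 0) (h1 : P ≠ 1) : P.rank = 1 := by
  have hmul : P * (1 - P) = 0 := by rw [Matrix.mul_sub, Matrix.mul_one, hP, sub_self]
  have hle := rank_add_rank_le_card_of_mul_eq_zero hmul
  have hpos := rank_pos_of_ne_zero h0
  have hpos' := rank_pos_of_ne_zero (sub_ne_zero.mpr h1.symm)
  rw [Fintype.card_fin] at hle
  omega

/-- Proportional nonzero idempotents coincide. -/
theorem eq_of_idempotent_of_eq_smul {R : Type*} [Ring R] [Algebra ℂ R] {P Q : R}
    (hP : P * P = P) (hQ : Q * Q = Q) (h0 : P ≠ 0) {c : ℂ} (h : P = c • Q) : P = Q := by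
  have hc : c • P = P := by
    conv_rhs => rw [← hP, h, smul_mul_smul_comm, hQ, mul_smul, ← h]
  have hc1 : (c - 1) • P = 0 := by rw [sub_smul, hc, one_smul, sub_self]
  rcases smul_eq_zero.mp hc1 with hc1 | hc1
  · rw [h, sub_eq_zero.mp hc1, one_smul]
  · exact absurd hc1 h0

/-- A `2 × 2` matrix commuting with two noncommuting matrices is scalar. -/
theorem eq_smul_one_of_commute {N Q R : Matrix (Fin 2) (Fin 2) ℂ} (hQ : N * Q = Q * N)
    (hR : N * R = R * N) (hQR : Q * R ≠ R * Q) : N = N 0 0 • (1 : Matrix (Fin 2) (Fin 2) ℂ) := by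
  by_contra hN
  apply hQR
  have eQ := fun i j => congrFun (congrFun hQ i) j
  have eR := fun i j => congrFun (congrFun hR i) j
  simp only [Matrix.mul_apply, Fin.sum_univ_two, Fin.forall_fin_two] at eQ eR
  have hN' : N 0 1 ≠ 0 ∨ N 1 0 ≠ 0 ∨ N 0 0 - N 1 1 ≠ 0 := by
    by_contra! H
    obtain ⟨H1, H2, H3⟩ := H
    apply hN
    ext i j
    fin_cases i <;> fin_cases j <;> simp [H1, H2, sub_eq_zero.mp H3]
  obtain ⟨⟨eQ1, eQ2⟩, eQ3, eQ4⟩ := eQ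
  obtain ⟨⟨eR1, eR2⟩, eR3, eR4⟩ := eR
  ext i j
  simp only [Matrix.mul_apply, Fin.sum_univ_two]
  rcases hN' with h | h | h <;> apply mul_left_cancel₀ h <;> fin_cases i <;> fin_cases j <;>
    simp only [Fin.zero_eta, Fin.mk_one] <;> grind

namespace IsPVM2

variable {P : Fin 2 → Fin 2 → Matrix (Fin 2) (Fin 2) ℂ}

theorem one_sub {m : ℕ} {P : Fin 2 → Fin 2 → Matrix (Fin m) (Fin m) ℂ} (hP : IsPVM2 P)
    (x : Fin 2) : P 1 x = 1 - P 0 x :=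
  eq_sub_of_add_eq' (hP.2.2 x)

theorem not_commute {m : ℕ} {P : Fin 2 → Fin 2 → Matrix (Fin m) (Fin m) ℂ} (hP : IsPVM2 P)
    (hnc : P 0 0 * P 0 1 ≠ P 0 1 * P 0 0) (a a' : Fin 2) : ¬ Commute (P a 0) (P a' 1) := by
  intro h
  apply hnc
  have h' : Commute (P 0 0) (P a' 1) := by
    fin_cases a
    · exact h
    · rw [eq_sub_of_add_eq (hP.2.2 0)]
      exact (Commute.one_left _).sub_left h
  fin_cases a'
  · exact h'
  · rw [eq_sub_of_add_eq (hP.2.2 1)]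
    exact (Commute.one_right _).sub_right h'

theorem ne_zero_and_ne_one {m : ℕ} {P : Fin 2 → Fin 2 → Matrix (Fin m) (Fin m) ℂ} (hP : IsPVM2 P)
    (hnc : P 0 0 * P 0 1 ≠ P 0 1 * P 0 0) (a x : Fin 2) : P a x ≠ 0 ∧ P a x ≠ 1 := by
  have h0 := hP.not_commute hnc a 0
  have h1 := hP.not_commute hnc 0 a
  fin_cases x
  · constructor <;> intro h <;> simp only [Fin.zero_eta] at h <;> simp [h] at h0
  · constructor <;> intro h <;> simp only [Fin.mk_one] at h <;> simp [h] at h1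

theorem injective {m : ℕ} {P : Fin 2 → Fin 2 → Matrix (Fin m) (Fin m) ℂ} (hP : IsPVM2 P)
    (hnc : P 0 0 * P 0 1 ≠ P 0 1 * P 0 0) {a x a' x' : Fin 2} (h : P a x = P a' x') :
    (a, x) = (a', x') := by
  have hcomm : ∀ b b', P b 0 ≠ P b' 1 := fun b b' hb =>
    hP.not_commute hnc b b' (hb ▸ Commute.refl _)
  have hout : ∀ y, P 0 y ≠ P 1 y := fun y hy => by
    apply (hP.ne_zero_and_ne_one hnc 0 y).1
    have h2 := hP.2.1 0 y
    nth_rewrite 2 [hy] at h2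
    rwa [hP.one_sub, mul_sub, mul_one, hP.2.1, sub_self, eq_comm] at h2
  fin_cases a <;> fin_cases x <;> fin_cases a' <;> fin_cases x' <;>
    first
    | rfl
    | exact absurd h (hcomm _ _)
    | exact absurd h.symm (hcomm _ _)
    | exact absurd h (hout _)
    | exact absurd h.symm (hout _)

theorem sigOf_ne_zero_and_rank {d : ℕ} {φ : Fin 2 × Fin d → ℂ} (hφ : IsEntangled φ)
    (hP : IsPVM2 P) (hnc : P 0 0 * P 0 1 ≠ P 0 1 * P 0 0) (a x : Fin 2) :
    sigOf φ P a x ≠ 0 ∧ (sigOf φ P a x).rank = 1 := by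
  obtain ⟨L, hL⟩ := hφ.exists_leftInverse
  have hrank : (sigOf φ P a x).rank = 1 := by
    obtain ⟨h0, h1⟩ := hP.ne_zero_and_ne_one hnc a x
    rw [sigOf_eq_mul, rank_conj_of_leftInverse hL, rank_transpose,
      rank_eq_one_of_idempotent (hP.2.1 a x) h0 h1]
  exact ⟨fun h => by simp [h] at hrank, hrank⟩

theorem sigOf_ne_smul {d : ℕ} {φ : Fin 2 × Fin d → ℂ} (hφ : IsEntangled φ)
    (hP : IsPVM2 P) (hnc : P 0 0 * P 0 1 ≠ P 0 1 * P 0 0) {a x a' x' : Fin 2}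
    (hne : (a, x) ≠ (a', x')) (c : ℂ) : sigOf φ P a x ≠ c • sigOf φ P a' x' := by
  intro h
  obtain ⟨L, hL⟩ := hφ.exists_leftInverse
  rw [sigOf_eq_mul, sigOf_eq_mul, ← Matrix.smul_mul, ← Matrix.mul_smul, ← transpose_smul] at h
  have h' : P a x = c • P a' x' := transpose_injective (conj_injective_of_leftInverse hL h)
  exact hne (hP.injective hnc (eq_of_idempotent_of_eq_smul (hP.2.1 a x) (hP.2.1 a' x')
    (hP.ne_zero_and_ne_one hnc a x).1 h'))

end IsPVM2

theorem sigOf_smul {d : ℕ} (c : ℂ) (φ : Fin 2 × Fin d → ℂ)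
    (P : Fin 2 → Fin 2 → Matrix (Fin 2) (Fin 2) ℂ) (a x : Fin 2) :
    sigOf (c • φ) P a x = (c * star c) • sigOf φ P a x := by
  have hM : coeffMatrix (c • φ) = c • coeffMatrix φ := rfl
  rw [sigOf_eq_mul, sigOf_eq_mul, hM, conjTranspose_smul, Matrix.smul_mul, Matrix.smul_mul,
    Matrix.mul_smul, smul_smul]

/-- If the congruence by a left-invertible `N` rescales both an idempotent and its complement,
then `N` commutes with the idempotent. -/
theorem commute_of_conj_eq_smul {m : Type*} [Fintype m] [DecidableEq m] {N K Q : Matrix m m ℂ}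
    (hK : K * N = 1) (hQ : Q * Q = Q) {c c' : ℂ} (h : N * Q * Nᴴ = c • Q)
    (h' : N * (1 - Q) * Nᴴ = c' • (1 - Q)) : N * Q = Q * N := by
  have hK' : Nᴴ * Kᴴ = 1 := by rw [← conjTranspose_mul, hK, conjTranspose_one]
  have key : ∀ (R : Matrix m m ℂ) (b : ℂ), N * R * Nᴴ = b • R → N * R = b • (R * Kᴴ) := by
    intro R b hR
    rw [← Matrix.smul_mul, ← hR, Matrix.mul_assoc _ Nᴴ, hK', Matrix.mul_one]
  have h1 : Q * (N * Q) = N * Q := by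
    rw [key Q c h, Matrix.mul_smul, ← Matrix.mul_assoc, hQ]
  have h2 : Q * (N * (1 - Q)) = 0 := by
    rw [key _ c' h', Matrix.mul_smul, ← Matrix.mul_assoc, Matrix.mul_sub, hQ, Matrix.mul_one,
      sub_self, Matrix.zero_mul, smul_zero]
  rw [Matrix.mul_sub, Matrix.mul_one, Matrix.mul_sub, h1, sub_eq_zero] at h2
  exact h2.symm

/-- Entangled vectors with entrywise proportional assemblages are proportional. -/
theorem IsPVM2.exists_eq_smul_of_sigOf_eq_smul {d : ℕ} {φ₁ φ₂ : Fin 2 × Fin d → ℂ}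
    {P : Fin 2 → Fin 2 → Matrix (Fin 2) (Fin 2) ℂ} (hP : IsPVM2 P)
    (h₁ : IsEntangled φ₁) (h₂ : IsEntangled φ₂) (hnc : P 0 0 * P 0 1 ≠ P 0 1 * P 0 0)
    (h : ∀ a x, ∃ c : ℂ, sigOf φ₁ P a x = c • sigOf φ₂ P a x) : ∃ c : ℂ, φ₁ = c • φ₂ := by
  choose c hc using h
  obtain ⟨L₁, hL₁⟩ := h₁.exists_leftInverse
  obtain ⟨L₂, hL₂⟩ := h₂.exists_leftInverse
  simp only [sigOf_eq_mul] at hc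
  set M₁ := coeffMatrix φ₁ with hM₁
  set M₂ := coeffMatrix φ₂ with hM₂
  have hL₁' : M₁ᴴ * L₁ᴴ = 1 := by rw [← conjTranspose_mul, hL₁, conjTranspose_one]
  obtain ⟨N, hN⟩ : ∃ N : Matrix (Fin 2) (Fin 2) ℂ, M₁ = M₂ * N := by
    refine ⟨(c 0 0 • (P 0 0)ᵀ + c 1 0 • (P 1 0)ᵀ) * (M₂ᴴ * L₁ᴴ), ?_⟩
    have hsum : M₁ * M₁ᴴ = M₂ * (c 0 0 • (P 0 0)ᵀ + c 1 0 • (P 1 0)ᵀ) * M₂ᴴ := by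
      rw [Matrix.mul_add, Matrix.add_mul, Matrix.mul_smul, Matrix.mul_smul, Matrix.smul_mul,
        Matrix.smul_mul, ← hc, ← hc, ← Matrix.add_mul, ← Matrix.mul_add, ← transpose_add,
        hP.2.2, transpose_one, Matrix.mul_one]
    calc M₁ = M₁ * M₁ᴴ * L₁ᴴ := by rw [Matrix.mul_assoc, hL₁', Matrix.mul_one]
      _ = _ := by rw [hsum]; simp only [Matrix.mul_assoc]
  have hconj : ∀ a x, N * (P a x)ᵀ * Nᴴ = c a x • (P a x)ᵀ := fun a x => by
    apply conj_injective_of_leftInverse hL₂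
    change M₂ * (N * (P a x)ᵀ * Nᴴ) * M₂ᴴ = M₂ * (c a x • (P a x)ᵀ) * M₂ᴴ
    rw [Matrix.mul_smul, Matrix.smul_mul, ← hc, hN, conjTranspose_mul]
    simp only [Matrix.mul_assoc]
  have hK : L₁ * M₂ * N = 1 := by rw [Matrix.mul_assoc, ← hN, hL₁]
  have hcomm : ∀ x, N * (P 0 x)ᵀ = (P 0 x)ᵀ * N := fun x => by
    refine commute_of_conj_eq_smul hK ?_ (hconj 0 x) (c' := c 1 x) ?_
    · rw [← transpose_mul, hP.2.1]
    · have := hconj 1 x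
      rwa [hP.one_sub, transpose_sub, transpose_one] at this
  have hscalar := eq_smul_one_of_commute (hcomm 0) (hcomm 1) fun hQR => by
    rw [← transpose_mul, ← transpose_mul] at hQR
    exact hnc (transpose_injective hQR).symm
  refine ⟨N 0 0, ?_⟩
  rw [hscalar, Matrix.mul_smul, Matrix.mul_one] at hN
  ext ⟨l, u⟩
  exact congrFun (congrFun hN u) l

end Auxiliary

/-- For entangled `φ₁, φ₂ ∈ ℂ² ⊗ ℂ^d` and two non-commuting two-outcome PVMs on `ℂ²`, the
four conditional states of each `φ_j` are nonzero, rank one, and mutually non-proportional;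
moreover `φ₁, φ₂` are linearly dependent iff the two assemblages are entrywise proportional
with nonzero factors. -/
theorem entangled_states_give_typeIII_assemblages
    (d : ℕ) (φ₁ φ₂ : Fin 2 × Fin d → ℂ)
    (h₁ : IsEntangled φ₁) (h₂ : IsEntangled φ₂)
    (P : Fin 2 → Fin 2 → Matrix (Fin 2) (Fin 2) ℂ) (hP : IsPVM2 P)
    (hnc : P 0 0 * P 0 1 ≠ P 0 1 * P 0 0) :
    (∀ a x, sigOf φ₁ P a x ≠ 0 ∧ (sigOf φ₁ P a x).rank = 1) ∧
    (∀ a x, sigOf φ₂ P a x ≠ 0 ∧ (sigOf φ₂ P a x).rank = 1) ∧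
    (∀ a x a' x', (a, x) ≠ (a', x') →
      ∀ c : ℂ, sigOf φ₁ P a x ≠ c • sigOf φ₁ P a' x') ∧
    (∀ a x a' x', (a, x) ≠ (a', x') →
      ∀ c : ℂ, sigOf φ₂ P a x ≠ c • sigOf φ₂ P a' x') ∧
    (¬ LinearIndependent ℂ ![φ₁, φ₂] ↔
      ∀ a x, ∃ c : ℂ, c ≠ 0 ∧ sigOf φ₁ P a x = c • sigOf φ₂ P a x) := by
  refine ⟨IsPVM2.sigOf_ne_zero_and_rank h₁ hP hnc, IsPVM2.sigOf_ne_zero_and_rank h₂ hP hnc,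
    fun a x a' x' hne => IsPVM2.sigOf_ne_smul h₁ hP hnc hne,
    fun a x a' x' hne => IsPVM2.sigOf_ne_smul h₂ hP hnc hne, ?_⟩
  have hsymm : ¬ LinearIndependent ℂ ![φ₁, φ₂] ↔ ∃ c : ℂ, c • φ₂ = φ₁ := by
    rw [LinearIndependent.pair_symm_iff, LinearIndependent.pair_iff' h₂.1]
    push Not
    rfl
  rw [hsymm]
  constructor
  · rintro ⟨c, rfl⟩ a x
    have hc : c ≠ 0 := by
      rintro rfl
      exact h₁.1 (zero_smul ℂ φ₂)
    exact ⟨c * star c, mul_ne_zero hc (star_ne_zero.mpr hc), sigOf_smul c φ₂ P a x⟩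
  · intro h
    obtain ⟨c, hc⟩ := hP.exists_eq_smul_of_sigOf_eq_smul h₁ h₂ hnc fun a x =>
      (h a x).imp fun _ hc => hc.2
    exact ⟨c, hc.symm⟩
end

section
/- Let d ≥ 1 and let ψ ∈ ℂ²⊗ℂ²⊗ℂ^d be a genuinely three-party entangled unit vector. Then there exists an orthonormal basis (φ₀, φ₁) of the first qubit factor ℂ² such that the contractions of φ₀ and of φ₁ against the first factor of ψ are entangled vectors in ℂ²⊗ℂ^d and are linearly independent. -/
open scoped Classical

/-- An array all of whose `2 × 2` minors vanish is a product vector. -/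
theorem isProdVec_of_minors_eq_zero {m n : ℕ} {v : Fin m × Fin n → ℂ}
    (h : ∀ i j k l, v (i, k) * v (j, l) = v (i, l) * v (j, k)) : IsProdVec v := by
  by_cases hv : ∃ j k, v (j, k) ≠ 0
  · obtain ⟨j₀, k₀, h₀⟩ := hv
    refine ⟨fun j => v (j, k₀) / v (j₀, k₀), fun k => v (j₀, k), fun j k => ?_⟩
    field_simp
    exact h j j₀ k k₀
  · push Not at hv
    exact ⟨0, 0, fun j k => by simp [hv]⟩

/-- All `2 × 2` minors of a product vector vanish. -/
theorem IsProdVec.minor_eq {m n : ℕ} {v : Fin m × Fin n → ℂ} (h : IsProdVec v)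
    (i j : Fin m) (k l : Fin n) : v (i, k) * v (j, l) = v (i, l) * v (j, k) := by
  obtain ⟨u, w, huw⟩ := h
  simp only [huw]
  ring

theorem isEntangled_of_not_isProdVec {m n : ℕ} {v : Fin m × Fin n → ℂ} (h : ¬ IsProdVec v) :
    IsEntangled v := by
  refine ⟨?_, h⟩
  rintro rfl
  exact h ⟨0, 0, by simp⟩

theorem isProdVec_two {n : ℕ} {v : Fin 2 × Fin n → ℂ}
    (h : ∀ k l, v (0, k) * v (1, l) = v (0, l) * v (1, k)) : IsProdVec v := by
  refine isProdVec_of_minors_eq_zero fun i j k l => ?_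
  fin_cases i <;> fin_cases j <;> simp only [Fin.zero_eta, Fin.mk_one]
  · ring
  · exact h k l
  · linear_combination -(h k l)
  · ring

/-- If every vector in the span of the two slices of `ψ` is a product vector (as expressed by the
vanishing of the coefficients of all minors), then `ψ` splits across `B|AC` or `AB|C`. -/
theorem split_of_pencil_minors_eq_zero {d : ℕ} {ψ : Fin 2 × Fin 2 × Fin d → ℂ}
    (h : ∀ i k l, ψ (i, 0, k) * ψ (i, 1, l) = ψ (i, 0, l) * ψ (i, 1, k))
    (hc : ∀ k l, ψ (0, 0, k) * ψ (1, 1, l) + ψ (1, 0, k) * ψ (0, 1, l) =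
      ψ (0, 0, l) * ψ (1, 1, k) + ψ (1, 0, l) * ψ (0, 1, k)) :
    (∃ (u : Fin 2 → ℂ) (w : Fin 2 × Fin d → ℂ), ∀ i j k, ψ (i, j, k) = u j * w (i, k)) ∨
    (∃ (u : Fin 2 × Fin 2 → ℂ) (w : Fin d → ℂ), ∀ i j k, ψ (i, j, k) = u (i, j) * w k) := by
  have hp (i : Fin 2) : IsProdVec (fun p : Fin 2 × Fin d => ψ (i, p)) := isProdVec_two (h i)
  choose U W hUW using hp
  have hψ (i j k) : ψ (i, j, k) = U i j * W i k := hUW i j k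
  by_cases hU : U 0 0 * U 1 1 = U 0 1 * U 1 0
  · left
    have hUp : IsProdVec (fun p : Fin 2 × Fin 2 => U p.1 p.2) := by
      refine isProdVec_two fun k l => ?_
      fin_cases k <;> fin_cases l <;> simp only [Fin.zero_eta, Fin.mk_one] <;>
        first | ring1 | linear_combination hU | linear_combination -hU
    obtain ⟨c, e, hce⟩ := hUp
    refine ⟨e, fun p => c p.1 * W p.1 p.2, fun i j k => ?_⟩
    have := hce i j
    simp only at this
    rw [hψ, this]
    ring
  · right
    have hWp : IsProdVec (fun p : Fin 2 × Fin d => W p.1 p.2) := by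
      refine isProdVec_two fun k l => ?_
      have := hc k l
      simp only [hψ] at this
      refine mul_left_cancel₀ (sub_ne_zero.mpr hU) ?_
      linear_combination this
    obtain ⟨c, e, hce⟩ := hWp
    refine ⟨fun p => U p.1 p.2 * c p.1, e, fun i j k => ?_⟩
    have := hce i k
    simp only at this
    rw [hψ, this]
    ring

/-- A nonzero binary quadratic form is nonzero on both vectors of some real orthogonal pair
`(1, t)`, `(-t, 1)`. -/
theorem exists_real_quadratic_ne_zero {a b c : ℂ} (h : ¬ (a = 0 ∧ b = 0 ∧ c = 0)) :
    ∃ t : ℝ, a + b * t + c * t ^ 2 ≠ 0 ∧ a * t ^ 2 - b * t + c ≠ 0 := by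
  open Polynomial in
  let p : ℂ[X] := C a + C b * X + C c * X ^ 2
  let q : ℂ[X] := C a * X ^ 2 - C b * X + C c
  have hp : p ≠ 0 := by
    intro hp
    have h0 := congrArg (fun r => r.coeff 0) hp
    have h1 := congrArg (fun r => r.coeff 1) hp
    have h2 := congrArg (fun r => r.coeff 2) hp
    simp [p, coeff_X, coeff_C] at h0 h1 h2
    exact h ⟨h0, h1, h2⟩
  have hq : q ≠ 0 := by
    intro hq
    have h0 := congrArg (fun r => r.coeff 0) hq
    have h1 := congrArg (fun r => r.coeff 1) hq
    have h2 := congrArg (fun r => r.coeff 2) hq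
    simp [q, coeff_X, coeff_C] at h0 h1 h2
    exact h ⟨h2, h1, h0⟩
  have hfin : {t : ℝ | (p * q).IsRoot (t : ℂ)}.Finite :=
    (Polynomial.finite_setOfPred_isRoot (mul_ne_zero hp hq)).preimage
      Complex.ofReal_injective.injOn
  obtain ⟨t, ht⟩ := hfin.exists_notMem
  refine ⟨t, ?_⟩
  simpa [p, q, Polynomial.IsRoot, not_or] using ht

/-- The real orthonormal basis of `ℂ²` proportional to `(1, t)`, `(-t, 1)`. -/
noncomputable def rotationBasis (t : ℝ) : Fin 2 → Fin 2 → ℂ :=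
  ![![((√(1 + t ^ 2))⁻¹ : ℝ), ((√(1 + t ^ 2))⁻¹ * t : ℝ)],
    ![(-((√(1 + t ^ 2))⁻¹ * t) : ℝ), ((√(1 + t ^ 2))⁻¹ : ℝ)]]

theorem rotationBasis_orthonormal (t : ℝ) (i j : Fin 2) :
    ∑ k, (starRingEnd ℂ) (rotationBasis t i k) * rotationBasis t j k = if i = j then 1 else 0 := by
  have h : (√(1 + t ^ 2))⁻¹ ^ 2 * (1 + t ^ 2) = 1 := by
    rw [inv_pow, Real.sq_sqrt (by positivity)]
    exact inv_mul_cancel₀ (by positivity)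
  generalize hr : (√(1 + t ^ 2))⁻¹ = r at h
  have h' : (r : ℂ) ^ 2 * (1 + (t : ℂ) ^ 2) = 1 := by exact_mod_cast h
  fin_cases i <;> fin_cases j <;>
    simp only [rotationBasis, hr, Fin.sum_univ_two, Fin.zero_eta, Fin.mk_one, Complex.conj_ofReal,
      Matrix.cons_val_zero, Matrix.cons_val_one, Complex.ofReal_neg, Complex.ofReal_mul] <;>
    simp <;> first | ring1 | linear_combination h'

/-- Contractions of a vector that is not a product across `A|BC` against the vectors of an
orthonormal basis of the first factor are linearly independent. -/
theorem linearIndependent_contractA {dB dC : ℕ} {ψ : Fin 2 × Fin dB × Fin dC → ℂ}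
    (hψ : ¬ ∃ (u : Fin 2 → ℂ) (w : Fin dB × Fin dC → ℂ), ∀ i j k, ψ (i, j, k) = u i * w (j, k))
    {φ : Fin 2 → Fin 2 → ℂ}
    (hφ : ∀ i j, ∑ k, (starRingEnd ℂ) (φ i k) * φ j k = if i = j then 1 else 0) :
    LinearIndependent ℂ (fun i : Fin 2 => contractA (φ i) ψ) := by
  rw [Fintype.linearIndependent_iff]
  intro g hg
  rw [Fin.sum_univ_two] at hg
  set c : Fin 2 → ℂ := fun k => g 0 * (starRingEnd ℂ) (φ 0 k) + g 1 * (starRingEnd ℂ) (φ 1 k) with hc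
  have hcψ (j k) : c 0 * ψ (0, j, k) + c 1 * ψ (1, j, k) = 0 := by
    have := congrFun hg (j, k)
    simp only [contractA, Pi.add_apply, Pi.smul_apply, smul_eq_mul, Fin.sum_univ_two,
      Pi.zero_apply] at this
    simp only [hc]
    linear_combination this
  have hc0 : c 0 = 0 := by
    by_contra h
    refine hψ ⟨![-c 1 / c 0, 1], fun p => ψ (1, p), fun i j k => ?_⟩
    fin_cases i
    · simp only [Fin.zero_eta, Matrix.cons_val_zero]
      field_simp
      linear_combination hcψ j k
    · simp
  have hc1 : c 1 = 0 := by
    by_contra h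
    refine hψ ⟨![1, -c 0 / c 1], fun p => ψ (0, p), fun i j k => ?_⟩
    fin_cases i
    · simp
    · simp only [Fin.mk_one, Matrix.cons_val_one, Matrix.cons_val_fin_one]
      field_simp
      linear_combination hcψ j k
  have h00 := hφ 0 0
  have h10 := hφ 1 0
  have h01 := hφ 0 1
  have h11 := hφ 1 1
  simp [Fin.sum_univ_two] at h00 h10 h01 h11
  simp only [hc] at hc0 hc1
  intro i
  fin_cases i <;> simp only [Fin.zero_eta, Fin.mk_one]
  · linear_combination φ 0 0 * hc0 + φ 0 1 * hc1 - g 0 * h00 - g 1 * h10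
  · linear_combination φ 1 0 * hc0 + φ 1 1 * hc1 - g 0 * h01 - g 1 * h11

/-- For every genuinely three-party entangled unit vector `ψ ∈ ℂ² ⊗ ℂ² ⊗ ℂ^d` there is an
orthonormal basis of the first qubit factor whose two contractions against `ψ` are entangled
and linearly independent. -/
theorem exists_basis_entangled_contractions_of_genuinelyEntangled
    (d : ℕ) (hd : 1 ≤ d) (ψ : Fin 2 × Fin 2 × Fin d → ℂ) (hunit : UnitVec ψ)
    (hent : GenuinelyEntangled ψ) :
    ∃ φ : Fin 2 → Fin 2 → ℂ,
      (∀ i j, ∑ k, (starRingEnd ℂ) (φ i k) * φ j k = if i = j then 1 else 0) ∧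
      (∀ i, IsEntangled (contractA (φ i) ψ)) ∧
      LinearIndependent ℂ (fun i : Fin 2 => contractA (φ i) ψ) := by
  obtain ⟨k, l, hkl⟩ : ∃ k l : Fin d,
      ¬ (ψ (0, 0, k) * ψ (0, 1, l) - ψ (0, 0, l) * ψ (0, 1, k) = 0 ∧
        (ψ (0, 0, k) * ψ (1, 1, l) + ψ (1, 0, k) * ψ (0, 1, l)) -
          (ψ (0, 0, l) * ψ (1, 1, k) + ψ (1, 0, l) * ψ (0, 1, k)) = 0 ∧
        ψ (1, 0, k) * ψ (1, 1, l) - ψ (1, 0, l) * ψ (1, 1, k) = 0) := by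
    by_contra! hall
    rcases split_of_pencil_minors_eq_zero (ψ := ψ)
      (fun i k l => by
        fin_cases i
        · exact sub_eq_zero.mp (hall k l).1
        · exact sub_eq_zero.mp (hall k l).2.2)
      (fun k l => sub_eq_zero.mp (hall k l).2.1) with h | h
    · exact hent.2.1 h
    · exact hent.2.2 h
  obtain ⟨t, ht₀, ht₁⟩ := exists_real_quadratic_ne_zero hkl
  have hr : (((√(1 + t ^ 2))⁻¹ : ℝ) : ℂ) ≠ 0 := by
    exact_mod_cast inv_ne_zero (by positivity)
  refine ⟨rotationBasis t, rotationBasis_orthonormal t, fun i => isEntangled_of_not_isProdVec ?_,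
    linearIndependent_contractA hent.1 (rotationBasis_orthonormal t)⟩
  intro hprod
  have hm := hprod.minor_eq 0 1 k l
  generalize hr' : (√(1 + t ^ 2))⁻¹ = r at hr
  fin_cases i <;>
    simp only [contractA, rotationBasis, hr', Fin.sum_univ_two, Fin.zero_eta, Fin.mk_one,
      Matrix.cons_val_zero, Matrix.cons_val_one, Matrix.cons_val_fin_one, Complex.ofReal_neg,
      Complex.ofReal_mul, map_neg, map_mul, Complex.conj_ofReal] at hm
  · refine ht₀ (mul_left_cancel₀ (pow_ne_zero 2 hr) ?_)
    linear_combination hm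
  · refine ht₁ (mul_left_cancel₀ (pow_ne_zero 2 hr) ?_)
    linear_combination hm
end
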